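/- arXiv:1303.3857 — 3 statements merged into one kernel-verified Lean document; each statement's English description precedes it below -/
import Mathlib

section
/- Let u_n denote the number of permutations of [n] = {1,...,n} that avoid both of the patterns 1243 and 2134 (with u_0 = 1), and let F = Σ_{n≥0} u_n X^n be its generating function, regarded as a formal power series over ℤ. Then F satisfies the algebraic equation (2·(X−1)·(X²+4X−1)·F − (3X²−9X+2))² = X²·(1−X)²·(1−4X); equivalently, F = (3X²−9X+2 + X(1−X)√(1−4X)) / (2(X−1)(X²+4X−1)). -/
/-- `π` contains the pattern 1243: indices `i < j < k < l` with `π i < π j < π l < π k`. -/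
def Contains1243 {n : ℕ} (π : Equiv.Perm (Fin n)) : Prop :=
  ∃ i j k l : Fin n, i < j ∧ j < k ∧ k < l ∧ π i < π j ∧ π j < π l ∧ π l < π k

/-- `π` contains the pattern 2134: indices `i < j < k < l` with `π j < π i < π k < π l`. -/
def Contains2134 {n : ℕ} (π : Equiv.Perm (Fin n)) : Prop :=
  ∃ i j k l : Fin n, i < j ∧ j < k ∧ k < l ∧ π j < π i ∧ π i < π k ∧ π k < π l

/-- `π` avoids both patterns 1243 and 2134. -/
def AvoidsBoth {n : ℕ} (π : Equiv.Perm (Fin n)) : Prop :=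
  ¬ Contains1243 π ∧ ¬ Contains2134 π

/-- `u n` is the number of permutations of `[n]` avoiding both 1243 and 2134. -/
noncomputable def u (n : ℕ) : ℕ := Nat.card {π : Equiv.Perm (Fin n) // AvoidsBoth π}

def Dc (w : ℕ → ℕ) (t : ℕ) : Prop := ∀ i j, i < j → j < t → w j < w i
def Ic (w : ℕ → ℕ) (t : ℕ) : Prop := ∀ i j, i < j → j < t → w i < w j
def Ac (n : ℕ) (w : ℕ → ℕ) (t : ℕ) : Prop :=
  t ≤ n ∧ (∀ i j k, i < j → j < k → k < t → ¬ (w j < w i ∧ w i < w k)) ∧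
    (∀ i j k, i < j → j < t → t ≤ k → k < n → ¬ (w i < w j ∧ w j < w k))
def Av (n : ℕ) (w : ℕ → ℕ) : Prop :=
  (∀ i j k l, i < j → j < k → k < l → l < n → ¬ (w i < w j ∧ w j < w l ∧ w l < w k)) ∧
  (∀ i j k l, i < j → j < k → k < l → l < n → ¬ (w j < w i ∧ w i < w k ∧ w k < w l))

structure Ins (n s : ℕ) (w w' : ℕ → ℕ) : Prop where
  hs : s ≤ n
  lt : ∀ i, i < n → w i < n
  inj : ∀ i j, i < n → j < n → w i = w j → i = j
  a : ∀ i, i < s → w' i = w i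
  b : w' s = n
  c : ∀ i, s ≤ i → i < n → w' (i + 1) = w i

def sh (s i : ℕ) : ℕ := if i < s then i else i + 1

theorem Ins.sh {n s w w'} (H : Ins n s w w') (i : ℕ) (hi : i < n) : w' (sh s i) = w i := by
  unfold _root_.sh; split_ifs with h
  · exact H.a i h
  · exact H.c i (by omega) hi

theorem ex_sh (s n i : ℕ) (h : i ≠ s) (hi : i < n + 1) (hs : s ≤ n) : ∃ i', i = sh s i' ∧ i' < n := by
  by_cases h1 : i < s
  · exact ⟨i, by simp [sh, h1], by omega⟩
  · refine ⟨i - 1, ?_, by omega⟩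
    unfold sh; split_ifs <;> omega

theorem sh_lt {s i j : ℕ} : sh s i < sh s j ↔ i < j := by
  unfold sh; split_ifs <;> omega

theorem sh_lt_s {s i : ℕ} : sh s i < s ↔ i < s := by
  unfold sh; split_ifs <;> omega

theorem s_lt_sh {s i : ℕ} : s < sh s i ↔ s ≤ i := by
  unfold sh; split_ifs <;> omega

theorem sh_lt_n {s i n : ℕ} (hs : s ≤ n) : sh s i < n + 1 ↔ i < n := by
  unfold sh; split_ifs <;> omega

theorem sh_lt_t {s i t : ℕ} (hs : s < t) : sh s i < t ↔ i < t - 1 := by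
  unfold sh; split_ifs <;> omega

theorem Ins.av {n s w w'} (H : Ins n s w w') : Av (n+1) w' ↔ Av n w ∧ Ac n w s := by
  have hs := H.hs
  constructor
  · rintro ⟨h1, h2⟩
    refine ⟨⟨?_, ?_⟩, H.hs, ?_, ?_⟩
    · intro i j k l hij hjk hkl hl
      have := h1 (_root_.sh s i) (_root_.sh s j) (_root_.sh s k) (_root_.sh s l) (sh_lt.2 hij) (sh_lt.2 hjk) (sh_lt.2 hkl) ((sh_lt_n hs).2 hl)
      rwa [H.sh i (by omega), H.sh j (by omega), H.sh k (by omega), H.sh l (by omega)] at this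
    · intro i j k l hij hjk hkl hl
      have := h2 (_root_.sh s i) (_root_.sh s j) (_root_.sh s k) (_root_.sh s l) (sh_lt.2 hij) (sh_lt.2 hjk) (sh_lt.2 hkl) ((sh_lt_n hs).2 hl)
      rwa [H.sh i (by omega), H.sh j (by omega), H.sh k (by omega), H.sh l (by omega)] at this
    · intro i j k hij hjk hk h
      have := h2 i j k s hij hjk hk (by omega)
      rw [H.a i (by omega), H.a j (by omega), H.a k (by omega), H.b] at this
      exact this ⟨h.1, h.2, H.lt k (by omega)⟩
    · intro i j k hij hjk hk hkn h
      have := h1 i j s (k+1) hij hjk (by omega) (by omega)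
      rw [H.a i (by omega), H.a j (by omega), H.c k (by omega) (by omega), H.b] at this
      exact this ⟨h.1, h.2, H.lt k (by omega)⟩
  · rintro ⟨⟨h1, h2⟩, -, h3, h4⟩
    have key : ∀ i, i < n + 1 → i ≠ s → ∃ i', i = _root_.sh s i' ∧ i' < n ∧ w' i = w i' ∧ w' i < n := by
      intro i hi hne
      obtain ⟨i', rfl, hi'⟩ := ex_sh s n i hne hi hs
      exact ⟨i', rfl, hi', H.sh _ hi', by rw [H.sh _ hi']; exact H.lt _ hi'⟩
    have hle : ∀ i, i < n + 1 → w' i ≤ n := by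
      intro i hi
      by_cases h : i = s
      · rw [h, H.b]
      · obtain ⟨_, _, _, _, h⟩ := key i hi h; omega
    constructor
    · rintro i j k l hij hjk hkl hl ⟨p1, p2, p3⟩
      have hk := hle k (by omega)
      have hi' : i ≠ s := by rintro rfl; have := H.b; omega
      have hj' : j ≠ s := by rintro rfl; have := H.b; omega
      have hl' : l ≠ s := by rintro rfl; have := H.b; omega
      obtain ⟨i, rfl, bi, ei, -⟩ := key i (by omega) hi'
      obtain ⟨j, rfl, bj, ej, -⟩ := key j (by omega) hj'
      obtain ⟨l, rfl, bl, el, -⟩ := key l (by omega) hl'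
      by_cases hk' : k = s
      · subst hk'
        rw [sh_lt_s] at hjk; rw [s_lt_sh] at hkl; rw [sh_lt] at hij
        exact h4 i j l hij hjk hkl bl (by omega)
      · obtain ⟨k, rfl, bk, ek, -⟩ := key k (by omega) hk'
        rw [sh_lt] at *
        exact h1 i j k l hij hjk hkl bl (by omega)
    · rintro i j k l hij hjk hkl hl ⟨p1, p2, p3⟩
      have hk := hle l (by omega)
      have hi' : i ≠ s := by rintro rfl; have := H.b; omega
      have hj' : j ≠ s := by rintro rfl; have := H.b; omega
      have hk' : k ≠ s := by rintro rfl; have := H.b; omega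
      obtain ⟨i, rfl, bi, ei, -⟩ := key i (by omega) hi'
      obtain ⟨j, rfl, bj, ej, -⟩ := key j (by omega) hj'
      obtain ⟨k, rfl, bk, ek, -⟩ := key k (by omega) hk'
      by_cases hl' : l = s
      · subst hl'
        rw [sh_lt_s] at hkl; rw [sh_lt] at hij hjk
        exact h3 i j k hij hjk hkl (by omega)
      · obtain ⟨l, rfl, bl, el, -⟩ := key l (by omega) hl'
        rw [sh_lt] at *
        exact h2 i j k l hij hjk hkl bl (by omega)

theorem Ins.key {n s w w'} (H : Ins n s w w') : ∀ i, i < n + 1 → i ≠ s → ∃ i', i = _root_.sh s i' ∧ i' < n ∧ w' i = w i' ∧ w' i < n := by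
  intro i hi hne
  obtain ⟨i', rfl, hi'⟩ := ex_sh s n i hne hi H.hs
  exact ⟨i', rfl, hi', H.sh _ hi', by rw [H.sh _ hi']; exact H.lt _ hi'⟩

theorem Ins.le {n s w w'} (H : Ins n s w w') : ∀ i, i < n + 1 → w' i ≤ n := by
  intro i hi
  by_cases h : i = s
  · rw [h, H.b]
  · obtain ⟨_, _, _, _, h⟩ := H.key i hi h; omega

theorem Ins.ac_le {n s w w'} (H : Ins n s w w') (t : ℕ) (ht : t ≤ s) : Ac (n+1) w' t ↔ Dc w t := by
  have hs := H.hs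
  constructor
  · rintro ⟨h0, h1, h2⟩ i j hij hj
    have := h2 i j s hij hj ht (by omega)
    rw [H.a i (by omega), H.a j (by omega), H.b] at this
    have h3 := H.lt j (by omega)
    have h4 := H.inj i j (by omega) (by omega)
    by_contra hc
    apply this; refine ⟨?_, h3⟩
    rcases Nat.lt_or_ge (w i) (w j) with h | h
    · exact h
    · exact absurd (h4 (by omega)) (by omega)
  · intro h
    refine ⟨by omega, ?_, ?_⟩
    · rintro i j k hij hjk hk ⟨p1, p2⟩
      rw [H.a i (by omega), H.a k (by omega)] at p2
      have := h i k (by omega) hk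
      omega
    · rintro i j k hij hjk hk hn ⟨p1, p2⟩
      rw [H.a i (by omega), H.a j (by omega)] at p1
      have := h i j (by omega) hjk
      omega

theorem Ins.ac_gt {n s w w'} (H : Ins n s w w') (t : ℕ) (ht : s < t) :
    Ac (n+1) w' t ↔ Ic w s ∧ Ac n w (t-1) := by
  have hs := H.hs
  constructor
  · rintro ⟨h0, h1, h2⟩
    refine ⟨?_, by omega, ?_, ?_⟩
    · intro i j hij hj
      have := h1 i j s hij hj ht
      rw [H.a i (by omega), H.a j (by omega), H.b] at this
      have h3 := H.lt i (by omega)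
      have h4 := H.inj i j (by omega) (by omega)
      by_contra hc
      apply this; refine ⟨?_, h3⟩
      rcases Nat.lt_or_ge (w j) (w i) with h | h
      · exact h
      · exact absurd (h4 (by omega)) (by omega)
    · intro i j k hij hjk hk
      have := h1 (_root_.sh s i) (_root_.sh s j) (_root_.sh s k) (sh_lt.2 hij) (sh_lt.2 hjk) ((sh_lt_t ht).2 hk)
      rwa [H.sh i (by omega), H.sh j (by omega), H.sh k (by omega)] at this
    · intro i j k hij hj hk hkn
      have := h2 (_root_.sh s i) (_root_.sh s j) (_root_.sh s k) (sh_lt.2 hij) ((sh_lt_t ht).2 hj)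
        (by have := (sh_lt_t (i := k) ht).1; omega) ((sh_lt_n hs).2 hkn)
      rwa [H.sh i (by omega), H.sh j (by omega), H.sh k (by omega)] at this
  · rintro ⟨hI, h0, h1, h2⟩
    refine ⟨by omega, ?_, ?_⟩
    · rintro i j k hij hjk hk ⟨p1, p2⟩
      have hk2 := H.le k (by omega)
      have hi' : i ≠ s := by rintro rfl; have := H.b; omega
      have hj' : j ≠ s := by rintro rfl; have := H.b; omega
      obtain ⟨i, rfl, bi, ei, -⟩ := H.key i (by omega) hi'
      obtain ⟨j, rfl, bj, ej, -⟩ := H.key j (by omega) hj'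
      by_cases hk' : k = s
      · subst hk'
        rw [sh_lt_s] at hjk; rw [sh_lt] at hij
        have := hI i j hij hjk; omega
      · obtain ⟨k, rfl, bk, ek, -⟩ := H.key k (by omega) hk'
        rw [sh_lt] at hij hjk
        exact h1 i j k hij hjk ((sh_lt_t ht).1 hk) (by omega)
    · rintro i j k hij hjk hk hn ⟨p1, p2⟩
      have hk2 := H.le k (by omega)
      have hi' : i ≠ s := by rintro rfl; have := H.b; omega
      have hj' : j ≠ s := by rintro rfl; have := H.b; omega
      obtain ⟨i, rfl, bi, ei, -⟩ := H.key i (by omega) hi'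
      obtain ⟨j, rfl, bj, ej, -⟩ := H.key j (by omega) hj'
      obtain ⟨k, rfl, bk, ek, -⟩ := H.key k (by omega) (by omega)
      rw [sh_lt] at hij
      exact h2 i j k hij ((sh_lt_t ht).1 hjk) (by have := (sh_lt_t (i := k) ht).2; omega) bk (by omega)

theorem Ins.dc_le {n s w w'} (H : Ins n s w w') (t : ℕ) (ht : t ≤ s) : Dc w' t ↔ Dc w t := by
  constructor <;> intro h i j hij hj <;> have := h i j hij hj
  · rwa [H.a i (by omega), H.a j (by omega)] at this
  · rwa [H.a i (by omega), H.a j (by omega)]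

theorem Ins.dc_gt {n s w w'} (H : Ins n s w w') (hs0 : 0 < s) (t : ℕ) (ht : s < t) : ¬ Dc w' t := by
  intro h
  have := h 0 s hs0 ht
  rw [H.b, H.a 0 hs0] at this
  have := H.lt 0 (by have := H.hs; omega)
  omega

theorem Ins.dc_zero {n w w'} (H : Ins n 0 w w') (t : ℕ) (ht : t ≤ n) : Dc w' (t+1) ↔ Dc w t := by
  constructor
  · intro h i j hij hj
    have := h (i+1) (j+1) (by omega) (by omega)
    rwa [H.c i (by omega) (by omega), H.c j (by omega) (by omega)] at this
  · intro h i j hij hj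
    obtain ⟨j, rfl⟩ : ∃ j', j = j' + 1 := ⟨j - 1, by omega⟩
    rw [H.c j (by omega) (by omega)]
    by_cases hi : i = 0
    · rw [hi, H.b]; exact H.lt _ (by omega)
    · obtain ⟨i, rfl⟩ : ∃ j', i = j' + 1 := ⟨i - 1, by omega⟩
      rw [H.c i (by omega) (by omega)]
      exact h i j (by omega) (by omega)

theorem Ins.ic {n s w w'} (H : Ins n s w w') (h : Ic w s) : Ic w' (s+1) := by
  intro i j hij hj
  have hs := H.hs
  by_cases hjs : j = s
  · rw [hjs, H.b, H.a i (by omega)]; exact H.lt _ (by omega)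
  · rw [H.a i (by omega), H.a j (by omega)]; exact h i j hij (by omega)

theorem Dc.ac {n w t} (h : Dc w t) (ht : t ≤ n) : Ac n w t := by
  refine ⟨ht, ?_, ?_⟩
  · rintro i j k hij hjk hk ⟨p1, p2⟩
    have := h i k (by omega) hk
    omega
  · rintro i j k hij hjk hk hn ⟨p1, p2⟩
    have := h i j (by omega) hjk
    omega

theorem Dc.mono {w t t'} (h : Dc w t) (ht : t' ≤ t) : Dc w t' := fun i j a b => h i j a (by omega)
theorem Dc.one (w) : Dc w 1 := fun i j a b => by omega
theorem Ic.one (w) : Ic w 1 := fun i j a b => by omega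
theorem Dc.not_ic {w s} (h : Dc w 2) (hs : 2 ≤ s) : ¬ Ic w s := fun h' => by
  have := h 0 1 (by omega) (by omega)
  have := h' 0 1 (by omega) (by omega)
  omega

theorem ic_ac_unique {n w p t} (hp : 2 ≤ p) (hpt : p < t) (h1 : Ac n w p) (h2 : Ic w t) (ht : t ≤ n) : False :=
  h1.2.2 0 1 p (by omega) (by omega) le_rfl (by omega) ⟨h2 _ _ (by omega) (by omega), h2 _ _ (by omega) (by omega)⟩

def J (n : ℕ) (w : ℕ → ℕ) : Prop := ¬ Dc w 2 → ∀ t, 2 ≤ t → Ac n w t →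
  ∃ p, 2 ≤ p ∧ Ic w p ∧ Ac n w p ∧ ∀ u, 2 ≤ u → Ac n w u → p ≤ u

theorem Ins.J {n s w w'} (H : Ins n s w w') (hn : 1 ≤ n) (hs : Ac n w s) : J (n+1) w' := by
  intro hd t ht hA
  rcases Nat.lt_or_ge s 2 with h2 | h2
  · interval_cases s
    · exact absurd ((H.dc_zero 1 hn).2 (Dc.one _)) hd
    · refine ⟨2, le_rfl, H.ic (Ic.one _), ?_, fun u hu _ => hu⟩
      rw [H.ac_gt 2 (by omega)]
      exact ⟨Ic.one _, (Dc.one _).ac hn⟩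
  · rw [H.dc_le 2 h2] at hd
    have hgt : ∀ u, 2 ≤ u → Ac (n+1) w' u → s < u := by
      intro u hu hu'
      by_contra hc
      rw [H.ac_le u (by omega)] at hu'
      exact hd (hu'.mono hu)
    have := hgt t ht hA
    have hI := ((H.ac_gt t this).1 hA).1
    refine ⟨s+1, by omega, H.ic hI, ?_, hgt⟩
    rw [H.ac_gt _ (by omega)]
    exact ⟨hI, hs⟩

open Classical in
noncomputable def dd (n : ℕ) (w : ℕ → ℕ) : ℕ := ((Finset.Icc 1 n).filter (fun t => Dc w t)).card

open Classical in
noncomputable def eS (n : ℕ) (w : ℕ → ℕ) : Finset ℕ :=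
  (Finset.Icc 1 n).filter (fun t => Ac n w t ∧ ¬ Dc w t)

noncomputable def ee (n : ℕ) (w : ℕ → ℕ) : ℕ := (eS n w).card

theorem dd_eq {n w d} (hd : d ≤ n) (h : ∀ t, 1 ≤ t → t ≤ n → (Dc w t ↔ t ≤ d)) : dd n w = d := by
  classical
  unfold dd
  have : (Finset.Icc 1 n).filter (fun t => Dc w t) = Finset.Icc 1 d := by
    ext t; simp only [Finset.mem_filter, Finset.mem_Icc]
    constructor
    · rintro ⟨⟨a, b⟩, c⟩; exact ⟨a, (h t a b).1 c⟩
    · rintro ⟨a, b⟩; exact ⟨⟨a, by omega⟩, (h t a (by omega)).2 b⟩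
  rw [this]; simp

theorem dc_iff {n w} : dd n w ≤ n ∧ ∀ t, t ≤ n → (Dc w t ↔ t ≤ dd n w) := by
  classical
  have h0 : Dc w 0 := fun i j _ hj => by omega
  have key : ∀ t, t ≤ n → (Dc w t ↔ t ≤ Nat.findGreatest (Dc w) n) := by
    intro t ht
    constructor
    · intro h; exact Nat.le_findGreatest ht h
    · intro h
      exact (Nat.findGreatest_spec (P := Dc w) (Nat.zero_le n) h0).mono h
  have := dd_eq (n := n) (w := w) (Nat.findGreatest_le n) (fun t _ ht => key t ht)
  rw [this]
  exact ⟨Nat.findGreatest_le n, key⟩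

theorem one_le_dd {n w} (hn : 1 ≤ n) : 1 ≤ dd n w := (dc_iff.2 1 hn).1 (Dc.one w)

theorem mem_eS {n w t} : t ∈ eS n w ↔ Ac n w t ∧ dd n w < t := by
  classical
  unfold eS
  simp only [Finset.mem_filter, Finset.mem_Icc]
  constructor
  · rintro ⟨⟨a, b⟩, c, d⟩
    rw [dc_iff.2 t b] at d
    exact ⟨c, by omega⟩
  · rintro ⟨c, d⟩
    have := c.1
    refine ⟨⟨by omega, this⟩, c, ?_⟩
    rw [dc_iff.2 t this]; omega

theorem Ins.dd_zero {n w w'} (H : Ins n 0 w w') : dd (n+1) w' = dd n w + 1 := by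
  have := dc_iff (n := n) (w := w)
  refine dd_eq (by omega) ?_
  intro t h1 h2
  obtain ⟨t, rfl⟩ : ∃ t', t = t' + 1 := ⟨t - 1, by omega⟩
  rw [H.dc_zero t (by omega), this.2 t (by omega)]; omega

theorem Ins.dd_pos {n s w w'} (H : Ins n s w w') (h0 : 0 < s) : dd (n+1) w' = min s (dd n w) := by
  have := dc_iff (n := n) (w := w)
  have hs := H.hs
  refine dd_eq (by omega) ?_
  intro t h1 h2
  by_cases h : t ≤ s
  · rw [H.dc_le t h, this.2 t (by omega)]; omega
  · have := H.dc_gt h0 t (by omega)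
    simp only [this, false_iff]; omega

theorem Ins.ee_zero {n w w'} (H : Ins n 0 w w') : ee (n+1) w' = ee n w := by
  have : eS (n+1) w' = (eS n w).image (· + 1) := by
    ext t
    simp only [Finset.mem_image, mem_eS, H.dd_zero]
    constructor
    · rintro ⟨a, b⟩
      rw [H.ac_gt t (by omega)] at a
      exact ⟨t - 1, ⟨a.2, by omega⟩, by omega⟩
    · rintro ⟨t, ⟨a, b⟩, rfl⟩
      rw [H.ac_gt _ (by omega)]
      exact ⟨⟨fun i j _ _ => by omega, a⟩, by omega⟩
  unfold ee
  rw [this, Finset.card_image_of_injective _ (add_left_injective 1)]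

theorem Ins.eS_not {n s w w'} (H : Ins n s w w') (h0 : 0 < s) (hI : ¬ Ic w s) : ee (n+1) w' = 0 := by
  unfold ee
  rw [Finset.card_eq_zero, Finset.eq_empty_iff_forall_notMem]
  intro t ht
  rw [mem_eS, H.dd_pos h0] at ht
  have hs := H.hs
  by_cases h : t ≤ s
  · rw [H.ac_le t h, (dc_iff (n := n)).2 t (by omega)] at ht; omega
  · rw [H.ac_gt t (by omega)] at ht; exact hI ht.1.1

open Classical in
theorem Ins.eS_ic {n s w w'} (H : Ins n s w w') (h0 : 0 < s) (hI : Ic w s) :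
    ee (n+1) w' = ((Finset.Icc s n).filter (fun t => Ac n w t)).card := by
  have : eS (n+1) w' = ((Finset.Icc s n).filter (fun t => Ac n w t)).image (· + 1) := by
    ext t
    have hs := H.hs
    simp only [Finset.mem_image, mem_eS, H.dd_pos h0, Finset.mem_filter, Finset.mem_Icc]
    constructor
    · rintro ⟨a, b⟩
      by_cases h : t ≤ s
      · rw [H.ac_le t h, (dc_iff (n := n)).2 t (by omega)] at a; omega
      rw [H.ac_gt t (by omega)] at a
      have := a.2.1
      exact ⟨t - 1, ⟨⟨by omega, by omega⟩, a.2⟩, by omega⟩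
    · rintro ⟨t, ⟨⟨a1, a2⟩, b⟩, rfl⟩
      rw [H.ac_gt _ (by omega)]
      exact ⟨⟨hI, b⟩, by omega⟩
  unfold ee
  rw [this, Finset.card_image_of_injective _ (add_left_injective 1)]

open Classical in
theorem card_ac {n w} : ((Finset.Icc 1 n).filter (fun t => Ac n w t)).card = dd n w + ee n w := by
  rw [← Finset.card_filter_add_card_filter_not (s := (Finset.Icc 1 n).filter (fun t => Ac n w t)) (fun t => Dc w t),
    Finset.filter_filter, Finset.filter_filter]
  congr 1
  unfold dd
  congr 1
  ext t
  simp only [Finset.mem_filter, Finset.mem_Icc]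
  constructor
  · tauto
  · rintro ⟨a, b⟩; exact ⟨a, b.ac a.2, b⟩

open Classical in
theorem sum_children {n : ℕ} {w : ℕ → ℕ} (hn : 1 ≤ n) (hJ : J n w) (w' : ℕ → ℕ → ℕ)
    (H : ∀ s, s ≤ n → Ins n s w (w' s)) (φ : ℕ → ℕ → ℕ) :
    ∑ s ∈ (Finset.range (n+1)).filter (fun s => Ac n w s), φ (dd (n+1) (w' s)) (ee (n+1) (w' s))
    = φ (dd n w + 1) (ee n w) + φ 1 (dd n w + ee n w) + ∑ j ∈ Finset.Icc 2 (dd n w), φ j 0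
      + (if dd n w = 1 ∧ 1 ≤ ee n w then φ 1 (ee n w) + (ee n w - 1) * φ 1 0
          else ee n w * φ (dd n w) 0) := by
  have hd1 := one_le_dd (w := w) hn
  obtain ⟨hdn, hdc⟩ := dc_iff (n := n) (w := w)
  have hset : (Finset.range (n+1)).filter (fun s => Ac n w s)
      = insert 0 (insert 1 (Finset.Icc 2 (dd n w) ∪ eS n w)) := by
    ext t
    simp only [Finset.mem_filter, Finset.mem_range, Finset.mem_insert, Finset.mem_union,
      Finset.mem_Icc, mem_eS]
    constructor
    · rintro ⟨a, b⟩
      by_cases h : t ≤ dd n w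
      · omega
      · exact Or.inr (Or.inr (Or.inr ⟨b, by omega⟩))
    · intro h
      by_cases ht : t ≤ dd n w
      · exact ⟨by omega, ((hdc t (by omega)).2 ht).ac (by omega)⟩
      · rcases h with h | h | h | h
        · omega
        · omega
        · omega
        · exact ⟨by have := h.1.1; omega, h.1⟩
  rw [hset, Finset.sum_insert, Finset.sum_insert, Finset.sum_union]
  · rw [(H 0 (by omega)).dd_zero, (H 0 (by omega)).ee_zero, (H 1 hn).dd_pos (by omega),
      (H 1 hn).eS_ic (by omega) (Ic.one _), card_ac, min_eq_left hd1, ← add_assoc, ← add_assoc]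
    congr 1
    · congr 1
      apply Finset.sum_congr rfl
      intro s hs
      rw [Finset.mem_Icc] at hs
      rw [(H s (by omega)).dd_pos (by omega), min_eq_left hs.2, (H s (by omega)).eS_not (by omega)]
      exact Dc.not_ic ((hdc 2 (by omega)).2 (by omega)) hs.1
    · have hdd : ∀ s ∈ eS n w, dd (n+1) (w' s) = dd n w := by
        intro s hs
        rw [mem_eS] at hs
        rw [(H s hs.1.1).dd_pos (by omega)]; omega
      split_ifs with hc
      · obtain ⟨hc1, hc2⟩ := hc
        have hnd : ¬ Dc w 2 := by
          intro h
          by_cases h2 : 2 ≤ n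
          · rw [hdc 2 h2] at h; omega
          · unfold ee at hc2
            obtain ⟨t, ht⟩ := Finset.card_pos.1 hc2
            rw [mem_eS] at ht
            have := ht.1.1
            omega
        obtain ⟨t, ht⟩ := Finset.card_pos.1 hc2
        rw [mem_eS] at ht
        obtain ⟨p, hp, hpI, hpA, hmin⟩ := hJ hnd t (by omega) ht.1
        have hpn := hpA.1
        have hpm : p ∈ eS n w := mem_eS.2 ⟨hpA, by omega⟩
        rw [← Finset.add_sum_erase _ _ hpm]
        congr 1
        · rw [hdd p hpm, hc1, (H p hpA.1).eS_ic (by omega) hpI]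
          congr 1
          unfold ee
          congr 1
          ext u
          simp only [Finset.mem_filter, Finset.mem_Icc, mem_eS]
          constructor
          · rintro ⟨a, b⟩; exact ⟨b, by omega⟩
          · rintro ⟨a, b⟩; exact ⟨⟨hmin u (by omega) a, a.1⟩, a⟩
        · rw [show ee n w - 1 = ((eS n w).erase p).card by rw [Finset.card_erase_of_mem hpm]; rfl,
            ← smul_eq_mul, ← Finset.sum_const]
          apply Finset.sum_congr rfl
          intro s hs
          rw [Finset.mem_erase] at hs
          rw [hdd s hs.2, hc1]
          have hs2 := mem_eS.1 hs.2
          have := hmin s (by omega) hs2.1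
          rw [(H s hs2.1.1).eS_not (by omega)]
          intro hI
          exact ic_ac_unique hp (by omega) hpA hI hs2.1.1
      · unfold ee
        rw [← smul_eq_mul, ← Finset.sum_const]
        apply Finset.sum_congr rfl
        intro s hs
        have hs2 := mem_eS.1 hs
        have h1 : 1 ≤ (eS n w).card := Finset.card_pos.2 ⟨s, hs⟩
        have hsn := hs2.1.1
        have hd2 : 2 ≤ dd n w := by
          by_contra hcc
          exact hc ⟨by omega, h1⟩
        rw [hdd s hs]
        have := (H s hs2.1.1).eS_not (by omega) (Dc.not_ic ((hdc 2 (by omega)).2 hd2) (by omega))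
        unfold ee at this
        rw [this]
  · rw [Finset.disjoint_left]
    intro t h1 h2
    rw [mem_eS] at h2; rw [Finset.mem_Icc] at h1; omega
  · simp [mem_eS]; intro _; omega
  · simp [mem_eS]

def wf {n : ℕ} (π : Equiv.Perm (Fin n)) (i : ℕ) : ℕ := if h : i < n then (π ⟨i, h⟩ : ℕ) else 0

theorem wf_fin {n : ℕ} (π : Equiv.Perm (Fin n)) (i : Fin n) : wf π i = (π i : ℕ) := by
  simp [wf]

theorem av_iff {n : ℕ} (π : Equiv.Perm (Fin n)) : AvoidsBoth π ↔ Av n (wf π) := by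
  unfold AvoidsBoth Av Contains1243 Contains2134
  constructor
  · rintro ⟨h1, h2⟩
    constructor
    · rintro i j k l hij hjk hkl hl ⟨a, b, c⟩
      apply h1
      refine ⟨⟨i, by omega⟩, ⟨j, by omega⟩, ⟨k, by omega⟩, ⟨l, by omega⟩, hij, hjk, hkl, ?_⟩
      simpa only [Fin.lt_def, ← wf_fin] using ⟨a, b, c⟩
    · rintro i j k l hij hjk hkl hl ⟨a, b, c⟩
      apply h2
      refine ⟨⟨i, by omega⟩, ⟨j, by omega⟩, ⟨k, by omega⟩, ⟨l, by omega⟩, hij, hjk, hkl, ?_⟩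
      simpa only [Fin.lt_def, ← wf_fin] using ⟨a, b, c⟩
  · rintro ⟨h1, h2⟩
    constructor
    · rintro ⟨i, j, k, l, hij, hjk, hkl, h⟩
      simp only [Fin.lt_def, ← wf_fin] at h
      exact h1 i j k l hij hjk hkl l.2 h
    · rintro ⟨i, j, k, l, hij, hjk, hkl, h⟩
      simp only [Fin.lt_def, ← wf_fin] at h
      exact h2 i j k l hij hjk hkl l.2 h

def insP {n : ℕ} (s : Fin (n+1)) (π : Equiv.Perm (Fin n)) : Equiv.Perm (Fin (n+1)) :=
  (finSuccEquiv' s).trans ((Equiv.optionCongr π).trans (finSuccEquiv' (Fin.last n)).symm)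

theorem insP_at {n : ℕ} (s : Fin (n+1)) (π : Equiv.Perm (Fin n)) : insP s π s = Fin.last n := by
  simp [insP]

theorem insP_sa {n : ℕ} (s : Fin (n+1)) (π : Equiv.Perm (Fin n)) (i : Fin n) :
    insP s π (s.succAbove i) = (π i).castSucc := by
  simp [insP]

theorem insP_ins {n : ℕ} (s : Fin (n+1)) (π : Equiv.Perm (Fin n)) :
    Ins n s (wf π) (wf (insP s π)) where
  hs := by omega
  lt i hi := by simp [wf, hi]
  inj i j hi hj h := by
    simp only [wf, hi, hj, dite_true] at h
    have := π.injective (Fin.ext h)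
    simpa using this
  a i hi := by
    have h := insP_sa s π ⟨i, by omega⟩
    rw [Fin.succAbove_of_castSucc_lt _ _ (by simpa [Fin.lt_def] using hi)] at h
    have h' := congrArg Fin.val h
    rw [← wf_fin] at h'
    simpa [← wf_fin] using h'
  b := by rw [wf_fin, insP_at]; simp
  c i hi hn := by
    have h := insP_sa s π ⟨i, by omega⟩
    rw [Fin.succAbove_of_le_castSucc _ _ (by simpa [Fin.le_def] using hi)] at h
    have h' := congrArg Fin.val h
    rw [← wf_fin] at h'
    simpa [← wf_fin] using h'

theorem insP_bij (n : ℕ) : Function.Bijective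
    (fun x : Equiv.Perm (Fin n) × Fin (n+1) => insP x.2 x.1) := by
  rw [Fintype.bijective_iff_injective_and_card]
  constructor
  · rintro ⟨π, s⟩ ⟨π', s'⟩ h
    simp only at h
    have hs : s = s' := by
      apply (insP s π).injective
      rw [insP_at, h, insP_at]
    subst hs
    congr 1
    ext i
    have := congrArg (fun q : Equiv.Perm (Fin (n+1)) => ((q (s.succAbove i) : Fin (n+1)) : ℕ)) h
    simpa [insP_sa] using this
  · simp [Fintype.card_perm, Nat.factorial_succ, mul_comm]

theorem J_wf {n : ℕ} (π : Equiv.Perm (Fin n)) (h : AvoidsBoth π) : J n (wf π) := by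
  rcases n with _ | _ | n
  · intro _ t ht hA; have := hA.1; omega
  · intro _ t ht hA; have := hA.1; omega
  · obtain ⟨⟨σ, s⟩, rfl⟩ := (insP_bij (n+1)).2 π
    rw [av_iff] at h
    have H := insP_ins s σ
    exact H.J (by omega) (H.av.1 h).2

def g : ℕ → ℕ → ℕ → ℕ
  | 0, _, _ => 1
  | m+1, d, e => g m (d+1) e + g m 1 (d+e) + ∑ j ∈ Finset.Icc 2 d, g m j 0
      + (if d = 1 ∧ 1 ≤ e then g m 1 e + (e - 1) * g m 1 0 else e * g m d 0)

open Classical in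
theorem sum_step (n m : ℕ) (hn : 1 ≤ n) :
    ∑ π : Equiv.Perm (Fin (n+1)) with AvoidsBoth π, g m (dd (n+1) (wf π)) (ee (n+1) (wf π))
    = ∑ π : Equiv.Perm (Fin n) with AvoidsBoth π, g (m+1) (dd n (wf π)) (ee n (wf π)) := by
  rw [Finset.sum_filter, ← (insP_bij n).sum_comp, Fintype.sum_prod_type, Finset.sum_filter]
  apply Finset.sum_congr rfl
  intro π _
  split_ifs with h
  · have hJ := J_wf π h
    rw [av_iff] at h
    let w' : ℕ → ℕ → ℕ := fun s => if hs : s < n + 1 then wf (insP ⟨s, hs⟩ π) else 0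
    have hw : ∀ s : Fin (n+1), w' s = wf (insP s π) := by intro s; simp only [w', s.2, dite_true]
    have H : ∀ s, s ≤ n → Ins n s (wf π) (w' s) := by
      intro s hs
      have := insP_ins ⟨s, by omega⟩ π
      rwa [← hw] at this
    rw [g, ← sum_children hn hJ w' H (g m), Finset.sum_filter, Finset.sum_range]
    apply Finset.sum_congr rfl
    intro s _
    have : AvoidsBoth (insP s π) ↔ Ac n (wf π) s := by
      rw [av_iff, (insP_ins s π).av]; tauto
    simp only [this, hw]
  · apply Finset.sum_eq_zero
    intro s _
    rw [if_neg]
    simp only [av_iff, (insP_ins s π).av]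
    rw [av_iff] at h
    tauto

open Classical in
theorem u_eq_sum (n m : ℕ) :
    ∑ π : Equiv.Perm (Fin (n+1)) with AvoidsBoth π, g m (dd (n+1) (wf π)) (ee (n+1) (wf π))
    = g (n + m) 1 0 := by
  induction n generalizing m with
  | zero =>
    have hdd : ∀ w, dd 1 w = 1 := fun w => le_antisymm (dc_iff.1) (one_le_dd le_rfl)
    have hee : ∀ w, ee 1 w = 0 := by
      intro w
      unfold ee
      rw [Finset.card_eq_zero, Finset.eq_empty_iff_forall_notMem]
      intro t ht
      rw [mem_eS, hdd] at ht
      have := ht.1.1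
      omega
    have hav : ∀ π : Equiv.Perm (Fin (0+1)), AvoidsBoth π := by
      intro π
      rw [av_iff]
      constructor <;> intro i j k l <;> intros <;> omega
    rw [Finset.filter_true_of_mem (fun π _ => hav π)]
    simp [hdd, hee]
  | succ n ih =>
    rw [sum_step _ _ (by omega), ih]
    congr 1; omega

theorem u_succ (n : ℕ) : u (n+1) = g n 1 0 := by
  classical
  rw [← Nat.add_zero n, ← u_eq_sum n 0]
  simp only [g, Finset.sum_const, smul_eq_mul, mul_one, u, Nat.card_eq_fintype_card,
    Fintype.card_subtype]

theorem u_zero : u 0 = 1 := by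
  unfold u
  rw [Nat.card_eq_one_iff_unique]
  refine ⟨⟨fun a b => Subtype.ext (Subsingleton.elim _ _)⟩, ⟨⟨1, ?_⟩⟩⟩
  rw [av_iff]
  constructor <;> intro i j k l <;> intros <;> omega

section GF
open PowerSeries

theorem exists_cat : ∃ C : ℤ⟦X⟧, C = 1 + X * C ^ 2 := by
  refine ⟨PowerSeries.map (Nat.castRingHom ℤ) catalanSeries, ?_⟩
  have := congrArg (PowerSeries.map (Nat.castRingHom ℤ)) catalanSeries_sq_mul_X_add_one
  simp only [map_add, map_mul, map_pow, map_one, map_X] at this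
  rw [← this]
  simp only [this]
  linear_combination -this

noncomputable def TT (C U : ℤ⟦X⟧) (d e : ℕ) : ℤ⟦X⟧ :=
  -(X * C * U) + (1 - X * C) * (1 - X) * U * C ^ d +
    (e : ℤ⟦X⟧) * (if d = 1 then X * C * U else X * ((1 - X * C) * (1 - X) * U) * C ^ (d + 1))

theorem TT_sum {C U : ℤ⟦X⟧} (hC : C = 1 + X * C ^ 2) (hU : (1 - X) * (1 - X - 2 * X * C) * U = 1)
    (d : ℕ) (hd : 1 ≤ d) : TT C U d 0 = 1 + X * (TT C U (d+1) 0 + TT C U 1 d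
      + ∑ j ∈ Finset.Icc 2 d, TT C U j 0) := by
  induction d, hd using Nat.le_induction with
  | base =>
    simp [TT]
    linear_combination ((1 - X) * U * (1 - X * C - X)) * hC + hU
  | succ d hd ih =>
    rw [Finset.sum_Icc_succ_top (by omega)]
    have : TT C U (d+1) 0 - TT C U d 0 = X * (TT C U (d+1+1) 0 - TT C U (d+1) 0) + X * (TT C U 1 (d+1) - TT C U 1 d) + X * TT C U (d+1) 0 := by
      simp [TT]
      linear_combination ((1 - X * C) * (1 - X) * U * C ^ d) * hC
    linear_combination ih + this

theorem TT_rec {C U : ℤ⟦X⟧} (hC : C = 1 + X * C ^ 2) (hU : (1 - X) * (1 - X - 2 * X * C) * U = 1)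
    (d e : ℕ) (hd : 1 ≤ d) : TT C U d e = 1 + X * (TT C U (d+1) e + TT C U 1 (d+e)
      + ∑ j ∈ Finset.Icc 2 d, TT C U j 0
      + (if d = 1 ∧ 1 ≤ e then TT C U 1 e + ((e - 1 : ℕ) : ℤ⟦X⟧) * TT C U 1 0
          else (e : ℤ⟦X⟧) * TT C U d 0)) := by
  have h0 := TT_sum hC hU d hd
  by_cases h1 : d = 1
  · subst h1
    rcases e with _ | e
    · simpa using h0
    · simp [TT] at h0 ⊢
      linear_combination h0 - (((e : ℤ⟦X⟧) + 1) * X ^ 2 * C ^ 2 * U * (1 - X)) * hC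
  · simp only [h1, false_and, if_false]
    have h2 : d ≠ 0 := by omega
    simp [TT, h1, h2] at h0 ⊢
    linear_combination h0 + ((e : ℤ⟦X⟧) * X * ((1 - X * C) * (1 - X) * U * C ^ d)) * hC

theorem coeff_TT {C U : ℤ⟦X⟧} (hC : C = 1 + X * C ^ 2) (hU : (1 - X) * (1 - X - 2 * X * C) * U = 1)
    (m : ℕ) : ∀ d e : ℕ, 1 ≤ d → coeff m (TT C U d e) = (g m d e : ℤ) := by
  induction m with
  | zero =>
    intro d e hd
    rw [TT_rec hC hU d e hd]
    simp [g]
  | succ m ih =>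
    intro d e hd
    rw [TT_rec hC hU d e hd, map_add, coeff_succ_X_mul, g]
    have hs : ∀ k : ℕ, ∀ P : ℤ⟦X⟧, coeff m ((k : ℤ⟦X⟧) * P) = k * coeff m P := by
      intro k P
      rw [← nsmul_eq_mul, map_nsmul, nsmul_eq_mul]
    rw [map_add, map_add, map_add, map_sum, ih _ _ (by omega), ih _ _ (by omega),
      Finset.sum_congr rfl (fun j hj => ih j 0 (by rw [Finset.mem_Icc] at hj; omega))]
    have : coeff (m+1) (1 : ℤ⟦X⟧) = 0 := by simp [coeff_one]
    rw [this]
    split_ifs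
    · rw [map_add, hs, ih _ _ le_rfl, ih _ _ le_rfl]; push_cast; ring
    · rw [hs, ih _ _ hd]; push_cast; ring

theorem F_eq {C U : ℤ⟦X⟧} (hC : C = 1 + X * C ^ 2) (hU : (1 - X) * (1 - X - 2 * X * C) * U = 1) :
    PowerSeries.mk (fun n => (u n : ℤ)) = 1 + X * TT C U 1 0 := by
  ext n
  rcases n with _ | n
  · simp [u_zero]
  · rw [coeff_mk, u_succ, map_add, coeff_succ_X_mul, coeff_TT hC hU n 1 0 le_rfl]
    simp [coeff_one]

end GF

open PowerSeries in
theorem stmt0 :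
    (2 * ((X : ℤ⟦X⟧) - 1) * (X ^ 2 + 4 * X - 1) * PowerSeries.mk (fun n => (u n : ℤ))
        - (3 * X ^ 2 - 9 * X + 2)) ^ 2
      = X ^ 2 * (1 - X) ^ 2 * (1 - 4 * X) := by
  obtain ⟨C, hC⟩ := exists_cat
  obtain ⟨U, hU⟩ : ∃ U : ℤ⟦X⟧, (1 - X) * (1 - X - 2 * X * C) * U = 1 := by
    have : IsUnit ((1 - X) * (1 - X - 2 * X * C) : ℤ⟦X⟧) := by
      rw [PowerSeries.isUnit_iff_constantCoeff]; simp
    obtain ⟨U, hU⟩ := this.exists_right_inv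
    exact ⟨U, hU⟩
  rw [F_eq hC hU]
  have hT : TT C U 1 0 = (1 - X - X * C) * U := by
    simp [TT]
    linear_combination (1 - X) * U * hC
  have hs : (1 - 2 * X * C) ^ 2 = 1 - 4 * (X : ℤ⟦X⟧) := by
    linear_combination - 4 * X * hC
  have key : 2 * ((X : ℤ⟦X⟧) - 1) * (X ^ 2 + 4 * X - 1) * (1 + X * TT C U 1 0)
        - (3 * X ^ 2 - 9 * X + 2) = X * (1 - X) * (1 - 2 * X * C) := by
    rw [hT]
    have h3 : ((X : ℤ⟦X⟧) - 1) * (X ^ 2 + 4 * X - 1) * U = 1 - 2 * X * C + X := by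
      linear_combination (1 - 2 * X * C + X) * hU - (1 - X) * U * hs
    linear_combination 2 * X * (1 - X - X * C) * h3 - 4 * X ^ 2 * hC
  rw [key]
  linear_combination X ^ 2 * (1 - X) ^ 2 * hs
end

section
/- Let u_n denote the number of permutations of [n] that avoid both of the patterns 1243 and 2134 (with u_0 = 1), let F = Σ_{n≥0} u_n X^n, and let C = Σ_{n≥0} C_n X^n be the generating function of the Catalan numbers, all as formal power series over ℤ. Then (1−X)·(1−X·C³)·F = (1−X)·(1−X·C³) + X. -/
namespace Sol

def DecP {n : ℕ} (σ : Equiv.Perm (Fin n)) (w : ℕ) : Prop :=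
  ∀ i j : Fin n, i < j → w ≤ (σ i : ℕ) → w ≤ (σ j : ℕ) → (σ j : ℕ) < (σ i : ℕ)

def IncP {n : ℕ} (σ : Equiv.Perm (Fin n)) (w : ℕ) : Prop :=
  ∀ i j : Fin n, i < j → w ≤ (σ i : ℕ) → w ≤ (σ j : ℕ) → (σ i : ℕ) < (σ j : ℕ)

def No132 {n : ℕ} (σ : Equiv.Perm (Fin n)) (w : ℕ) : Prop :=
  ∀ i j k : Fin n, i < j → j < k → w ≤ (σ i : ℕ) → (σ i : ℕ) < (σ k : ℕ) →
    (σ k : ℕ) < (σ j : ℕ) → False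

def No123 {n : ℕ} (σ : Equiv.Perm (Fin n)) (w : ℕ) : Prop :=
  ∀ i j k : Fin n, i < j → j < k → (σ i : ℕ) < w → w ≤ (σ j : ℕ) →
    (σ j : ℕ) < (σ k : ℕ) → False

def Act {n : ℕ} (σ : Equiv.Perm (Fin n)) (w : ℕ) : Prop := No132 σ w ∧ No123 σ w

/-- prepend the value `v` -/
noncomputable def consP {n : ℕ} (v : Fin (n + 1)) (σ : Equiv.Perm (Fin n)) :
    Equiv.Perm (Fin (n + 1)) :=
  Equiv.ofBijective (Fin.cons v (fun i => v.succAbove (σ i))) (by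
    rw [← Finite.injective_iff_bijective, Fin.cons_injective_iff]
    refine ⟨?_, ?_⟩
    · rintro ⟨i, hi⟩
      exact Fin.succAbove_ne _ _ hi
    · intro i j h
      exact σ.injective (Fin.succAbove_right_injective h))

theorem consP_zero {n : ℕ} (v : Fin (n + 1)) (σ : Equiv.Perm (Fin n)) : consP v σ 0 = v := rfl

theorem consP_succ {n : ℕ} (v : Fin (n + 1)) (σ : Equiv.Perm (Fin n)) (i : Fin n) :
    consP v σ i.succ = v.succAbove (σ i) := rfl

theorem consP_succ_val {n : ℕ} (v : Fin (n + 1)) (σ : Equiv.Perm (Fin n)) (i : Fin n) :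
    (consP v σ i.succ : ℕ) = if (σ i : ℕ) < v then (σ i : ℕ) else σ i + 1 := by
  rw [consP_succ, Fin.succAbove]
  simp only [Fin.lt_def, Fin.val_castSucc]
  split_ifs <;> simp

theorem consP_bij (n : ℕ) :
    Function.Bijective (fun p : Fin (n + 1) × Equiv.Perm (Fin n) => consP p.1 p.2) := by
  rw [Fintype.bijective_iff_injective_and_card]
  constructor
  · rintro ⟨v, σ⟩ ⟨v', σ'⟩ h
    simp only at h
    have h0 : v = v' := by simpa [consP_zero] using congrArg (fun f => f 0) h
    subst h0
    have : σ = σ' := by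
      ext1 i
      have := congrArg (fun f => f i.succ) h
      simp only [consP_succ] at this
      exact Fin.succAbove_right_injective this
    rw [this]
  · simp [Fintype.card_perm, Nat.factorial_succ]

theorem exists_val {n : ℕ} (σ : Equiv.Perm (Fin n)) (w : ℕ) (h : w < n) :
    ∃ i, (σ i : ℕ) = w := ⟨σ.symm ⟨w, h⟩, by simp⟩

theorem dec_gt {n : ℕ} (v : Fin (n + 1)) (σ : Equiv.Perm (Fin n)) (w : ℕ) (h : (v : ℕ) ≤ w) :
    DecP (consP v σ) (w + 1) ↔ DecP σ w := by
  simp only [DecP, Fin.forall_fin_succ, consP_zero, consP_succ_val, Fin.succ_lt_succ_iff]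
  grind

theorem inc_gt {n : ℕ} (v : Fin (n + 1)) (σ : Equiv.Perm (Fin n)) (w : ℕ) (h : (v : ℕ) ≤ w) :
    IncP (consP v σ) (w + 1) ↔ IncP σ w := by
  simp only [IncP, Fin.forall_fin_succ, consP_zero, consP_succ_val, Fin.succ_lt_succ_iff]
  grind

theorem dec_le {n : ℕ} (v : Fin (n + 1)) (σ : Equiv.Perm (Fin n)) (w : ℕ) (h : w ≤ (v : ℕ)) :
    DecP (consP v σ) w ↔ (v : ℕ) = n ∧ DecP σ w := by
  have := v.2
  simp only [DecP, Fin.forall_fin_succ, consP_zero, consP_succ_val, Fin.succ_lt_succ_iff]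
  constructor
  · rintro ⟨⟨_, h1⟩, h2⟩
    refine ⟨?_, ?_⟩
    · by_contra hv
      obtain ⟨i, hi⟩ := exists_val σ v (by omega)
      have := h1 i (Fin.succ_pos i)
      grind
    · grind
  · rintro ⟨h1, h2⟩
    have h3 : ∀ i, (σ i : ℕ) < v := fun i => by omega
    simp only [h3, if_true]
    grind

theorem inc_le {n : ℕ} (v : Fin (n + 1)) (σ : Equiv.Perm (Fin n)) (w : ℕ) (h : w ≤ (v : ℕ)) :
    IncP (consP v σ) w ↔ w = v ∧ IncP σ v := by
  have := v.2
  simp only [IncP, Fin.forall_fin_succ, consP_zero, consP_succ_val, Fin.succ_lt_succ_iff]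
  constructor
  · rintro ⟨⟨_, h1⟩, h2⟩
    refine ⟨?_, ?_⟩
    · by_contra hv
      obtain ⟨i, hi⟩ := exists_val σ w (by omega)
      have := h1 i (Fin.succ_pos i)
      grind
    · grind
  · rintro ⟨h1, h2⟩
    grind

theorem act_le {n : ℕ} (v : Fin (n + 1)) (σ : Equiv.Perm (Fin n)) (w : ℕ) (h : w ≤ (v : ℕ)) :
    Act (consP v σ) w ↔ IncP σ v ∧ Act σ w := by
  have hs : ∀ i : Fin n, (0 : Fin (n+1)) < i.succ := Fin.succ_pos
  have hinj : ∀ i j : Fin n, i < j → (σ i : ℕ) ≠ σ j := fun i j hij h =>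
    hij.ne (σ.injective (Fin.ext h))
  simp only [Act, No132, No123, IncP, Fin.forall_fin_succ, consP_zero, consP_succ_val,
    Fin.succ_lt_succ_iff, hs, Fin.not_lt_zero, lt_self_iff_false]
  constructor
  · rintro ⟨⟨⟨_, h1⟩, h2⟩, h3⟩
    refine ⟨?_, ?_, ?_⟩
    · grind
    · intro i j k hij hjk
      have := (h2 i).2 j
      grind
    · intro i j k hij hjk
      have := (h3.2 i).2 j
      grind
  · rintro ⟨h1, h2, h3⟩
    refine ⟨⟨⟨by simp, ?_⟩, ?_⟩, ?_⟩
    · grind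
    · intro i
      refine ⟨by simp, fun j => ⟨by simp, fun k hij hjk => ?_⟩⟩
      have := h2 i j k hij hjk
      grind
    · refine ⟨by grind, fun i => ⟨by simp, fun j => ⟨by simp, fun k hij hjk => ?_⟩⟩⟩
      have := h3 i j k hij hjk
      grind

theorem act_gt {n : ℕ} (v : Fin (n + 1)) (σ : Equiv.Perm (Fin n)) (w : ℕ) (h : (v : ℕ) ≤ w) :
    Act (consP v σ) (w + 1) ↔ DecP σ w := by
  have hs : ∀ i : Fin n, (0 : Fin (n+1)) < i.succ := Fin.succ_pos
  have hinj : ∀ i j : Fin n, i < j → (σ i : ℕ) ≠ σ j := fun i j hij h =>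
    hij.ne (σ.injective (Fin.ext h))
  simp only [Act, No132, No123, DecP, Fin.forall_fin_succ, consP_zero, consP_succ_val,
    Fin.succ_lt_succ_iff, hs, Fin.not_lt_zero, lt_self_iff_false]
  constructor
  · rintro ⟨_, ⟨_, h1⟩, h2⟩
    intro i j hij
    have := (h1 i).2 j
    have := hinj i j hij
    grind
  · intro h1
    refine ⟨⟨⟨by simp, by grind⟩, ?_⟩, ⟨⟨by simp, ?_⟩, ?_⟩⟩
    · intro i
      refine ⟨by simp, fun j => ⟨by simp, fun k hij hjk => ?_⟩⟩
      have := h1 i k (hij.trans hjk)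
      grind
    · grind
    · intro i
      refine ⟨by simp, fun j => ⟨by simp, fun k hij hjk => ?_⟩⟩
      have := h1 j k hjk
      grind

theorem avoids_cons {n : ℕ} (v : Fin (n + 1)) (σ : Equiv.Perm (Fin n)) :
    AvoidsBoth (consP v σ) ↔ AvoidsBoth σ ∧ Act σ v := by
  have hm : ∀ a b : Fin n, (consP v σ a.succ < consP v σ b.succ) ↔ σ a < σ b := by
    intro a b
    simp only [Fin.lt_def, consP_succ_val]
    grind
  have h1 : ∀ a : Fin n, (v < consP v σ a.succ) ↔ (v : ℕ) ≤ σ a := by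
    intro a
    simp only [Fin.lt_def, consP_succ_val]
    grind
  have h2 : ∀ a : Fin n, (consP v σ a.succ < v) ↔ (σ a : ℕ) < v := by
    intro a
    simp only [Fin.lt_def, consP_succ_val]
    grind
  have hs : ∀ i : Fin n, (0 : Fin (n+1)) < i.succ := Fin.succ_pos
  simp only [AvoidsBoth, Contains1243, Contains2134, Act, No132, No123, Fin.exists_fin_succ,
    consP_zero, hm, h1, h2, Fin.succ_lt_succ_iff, hs, Fin.not_lt_zero, lt_self_iff_false,
    ← Fin.lt_def]
  constructor
  · rintro ⟨h3, h4⟩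
    simp only [false_and, and_false, exists_false, false_or, true_and, not_or] at h3 h4
    refine ⟨⟨h3.2, h4.2⟩, ?_, ?_⟩
    · intro i j k hij hjk a b c
      exact h3.1 ⟨i, j, k, hij, hjk, a, b, c⟩
    · intro i j k hij hjk a b c
      exact h4.1 ⟨i, j, k, hij, hjk, a, b, c⟩
  · rintro ⟨⟨h3, h4⟩, h5, h6⟩
    simp only [false_and, and_false, exists_false, false_or, true_and, not_or]
    refine ⟨⟨?_, h3⟩, ⟨?_, h4⟩⟩
    · rintro ⟨i, j, k, hij, hjk, a, b, c⟩
      exact h5 i j k hij hjk a b c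
    · rintro ⟨i, j, k, hij, hjk, a, b, c⟩
      exact h6 i j k hij hjk a b c

open Classical in
/-- number of avoiding extensions by `m` further entries -/
noncomputable def ext : ℕ → {n : ℕ} → Equiv.Perm (Fin n) → ℕ
  | 0, _, _ => 1
  | m + 1, n, σ => ∑ v : Fin (n + 1), if Act σ v then ext m (consP v σ) else 0

open Classical in
theorem u_eq (m : ℕ) : ∀ n : ℕ,
    (∑ σ : Equiv.Perm (Fin n), if AvoidsBoth σ then ext m σ else 0) = u (n + m) := by
  induction m with
  | zero =>
    intro n
    simp [ext, u, Fintype.card_subtype]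
  | succ m ih =>
    intro n
    have := ih (n + 1)
    rw [show n + (m + 1) = n + 1 + m by ring, ← this,
      ← (consP_bij n).sum_comp (fun τ => if AvoidsBoth τ then ext m τ else 0),
      Fintype.sum_prod_type, Finset.sum_comm]
    refine Finset.sum_congr rfl fun σ _ => ?_
    simp only [avoids_cons, ext]
    by_cases h : AvoidsBoth σ <;> simp [h]

theorem u_eq' (m : ℕ) (n : ℕ) (h : n = 0) (σ : Equiv.Perm (Fin n)) : u m = ext m σ := by
  subst h
  have := u_eq m 0
  rw [Nat.zero_add] at this
  rw [← this, Fintype.sum_unique, if_pos]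
  · rw [Subsingleton.elim σ default]
  · exact ⟨fun ⟨i, _⟩ => i.elim0, fun ⟨i, _⟩ => i.elim0⟩

open Classical in
noncomputable def S {n : ℕ} (σ : Equiv.Perm (Fin n)) : Finset ℕ :=
  (Finset.range (n + 1)).filter (Act σ)

theorem mem_S {n : ℕ} (σ : Equiv.Perm (Fin n)) (w : ℕ) : w ∈ S σ ↔ w ≤ n ∧ Act σ w := by
  classical
  simp [S]

theorem ext_succ {n : ℕ} (σ : Equiv.Perm (Fin n)) (m : ℕ) (g : ℕ → ℤ)
    (h : ∀ v : Fin (n + 1), Act σ v → (ext m (consP v σ) : ℤ) = g v) :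
    (ext (m + 1) σ : ℤ) = ∑ v ∈ S σ, g v := by
  classical
  rw [ext, S, Finset.sum_filter, ← Fin.sum_univ_eq_sum_range (fun a => if Act σ a then g a else 0)]
  push_cast
  refine Finset.sum_congr rfl fun v _ => ?_
  split_ifs with hv
  · exact h v hv
  · rfl

theorem dec_cons {n : ℕ} (v : Fin (n + 1)) (σ : Equiv.Perm (Fin n)) (w : ℕ) :
    DecP (consP v σ) w ↔
      (w ≤ (v : ℕ) ∧ (v : ℕ) = n ∧ DecP σ w) ∨ ((v : ℕ) < w ∧ DecP σ (w - 1)) := by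
  rcases le_or_gt w (v : ℕ) with h | h
  · rw [dec_le v σ w h]
    have : ¬ (v : ℕ) < w := by omega
    simp [h, this]
  · obtain ⟨x, rfl⟩ : ∃ x, w = x + 1 := ⟨w - 1, by omega⟩
    rw [dec_gt v σ x (by omega)]
    have : ¬ x + 1 ≤ (v : ℕ) := by omega
    simp [h, this]

theorem inc_cons {n : ℕ} (v : Fin (n + 1)) (σ : Equiv.Perm (Fin n)) (w : ℕ) :
    IncP (consP v σ) w ↔
      (w = (v : ℕ) ∧ IncP σ v) ∨ ((v : ℕ) < w ∧ IncP σ (w - 1)) := by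
  rcases le_or_gt w (v : ℕ) with h | h
  · rw [inc_le v σ w h]
    have : ¬ (v : ℕ) < w := by omega
    simp [this]
  · obtain ⟨x, rfl⟩ : ∃ x, w = x + 1 := ⟨w - 1, by omega⟩
    rw [inc_gt v σ x (by omega)]
    have : ¬ x + 1 = (v : ℕ) := by omega
    simp [h, this]

theorem mem_S_cons {n : ℕ} (v : Fin (n + 1)) (σ : Equiv.Perm (Fin n)) (w : ℕ) :
    w ∈ S (consP v σ) ↔
      (w ≤ (v : ℕ) ∧ IncP σ v ∧ w ∈ S σ) ∨ ((v : ℕ) < w ∧ w ≤ n + 1 ∧ DecP σ (w - 1)) := by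
  have := v.2
  rw [mem_S, mem_S]
  rcases le_or_gt w (v : ℕ) with h | h
  · rw [act_le v σ w h]
    have h2 : ¬ (v : ℕ) < w := by omega
    have h3 : w ≤ n := by omega
    have h4 : w ≤ n + 1 := by omega
    simp [h2, h3, h4, h]
  · obtain ⟨x, rfl⟩ : ∃ x, w = x + 1 := ⟨w - 1, by omega⟩
    rw [act_gt v σ x (by omega)]
    have : ¬ x + 1 ≤ (v : ℕ) := by omega
    simp [h, this]

theorem inc_mono {n : ℕ} (σ : Equiv.Perm (Fin n)) {w w' : ℕ} (h : w ≤ w') (h' : IncP σ w) :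
    IncP σ w' := fun i j hij hi hj => h' i j hij (h.trans hi) (h.trans hj)

theorem inc_top {n : ℕ} (σ : Equiv.Perm (Fin n)) {w : ℕ} (h : n ≤ w + 1) : IncP σ w := by
  intro i j hij hi hj
  exact absurd (σ.injective (Fin.ext (by omega : (σ i : ℕ) = σ j))) hij.ne

structure IsD {n : ℕ} (σ : Equiv.Perm (Fin n)) (d r : ℕ) : Prop where
  hd : 2 ≤ d
  hn : d ≤ n
  dec : ∀ w ≤ n, (DecP σ w ↔ n ≤ w + d)
  inc : ∀ w ≤ n, (IncP σ w ↔ n ≤ w + 1)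
  top : ∀ w ≤ n, n ≤ w + d → w ∈ S σ
  card : (S σ).card = d + 1 + r

structure IsT {n : ℕ} (σ : Equiv.Perm (Fin n)) (r : ℕ) : Prop where
  hn : 1 ≤ n
  dec : ∀ w ≤ n, (DecP σ w ↔ n ≤ w + 1)
  top : ∀ w ≤ n, n ≤ w + 1 → w ∈ S σ
  card : (S σ).card = r + 2
  alt : (r = 0 ∧ ∀ w ∈ S σ, n ≤ w + 1) ∨
    (1 ≤ r ∧ ∃ w0, w0 + 1 < n ∧ IncP σ w0 ∧ w0 ∈ S σ ∧
      ∀ w ∈ S σ, IncP σ w → n ≤ w + 1 ∨ w = w0)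

theorem S_le {n : ℕ} {σ : Equiv.Perm (Fin n)} {w : ℕ} (h : w ∈ S σ) : w ≤ n :=
  ((mem_S σ w).1 h).1

theorem S_cons_big {n : ℕ} (v : Fin (n + 1)) (σ : Equiv.Perm (Fin n))
    (hv : n ≤ (v : ℕ) + 1) (hn : n ∈ S σ) (h : ∀ w ≤ n, n ≤ w + 1 → DecP σ w) :
    S (consP v σ) = insert (n + 1) (S σ) := by
  have := v.2
  ext w
  rw [mem_S_cons, Finset.mem_insert]
  have h1 : IncP σ v := inc_top σ hv
  constructor
  · rintro (⟨_, _, h⟩ | ⟨h2, h3, h4⟩)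
    · exact Or.inr h
    · have : w = n + 1 ∨ w = n := by omega
      rcases this with rfl | rfl
      · simp
      · exact Or.inr hn
  · rintro (rfl | h2)
    · exact Or.inr ⟨by omega, le_rfl, h _ (by simp) (by simp)⟩
    · have := S_le h2
      rcases le_or_gt w (v : ℕ) with h3 | h3
      · exact Or.inl ⟨h3, h1, h2⟩
      · exact Or.inr ⟨h3, by omega, h _ (by omega) (by omega)⟩

theorem card_big {n : ℕ} (σ : Equiv.Perm (Fin n)) :
    (insert (n + 1) (S σ)).card = (S σ).card + 1 := by
  rw [Finset.card_insert_of_notMem]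
  intro h
  have := S_le h
  omega

theorem IsD.child_n {n : ℕ} {σ : Equiv.Perm (Fin n)} {d r : ℕ} (H : IsD σ d r)
    (v : Fin (n + 1)) (hv : (v : ℕ) = n) : IsD (consP v σ) (d + 1) r := by
  have hS := S_cons_big v σ (by omega) (H.top n le_rfl (by omega))
    (fun w hw h => (H.dec w hw).2 (by have := H.hd; omega))
  have := H.hd
  have := H.hn
  refine ⟨by omega, by omega, ?_, ?_, ?_, ?_⟩
  · intro w hw
    rw [dec_cons]
    have h1 := H.dec w
    have h2 := H.dec (w - 1)
    grind
  · intro w hw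
    rw [inc_cons]
    have h1 := H.inc n
    have h2 := H.inc (w - 1)
    grind
  · intro w hw h
    rw [hS, Finset.mem_insert]
    have h1 := H.top w
    grind
  · rw [hS, card_big, H.card]; ring

theorem IsD.child_n1 {n : ℕ} {σ : Equiv.Perm (Fin n)} {d r : ℕ} (H : IsD σ d r)
    (v : Fin (n + 1)) (hv : (v : ℕ) + 1 = n) : IsT (consP v σ) (d + r) := by
  have hS := S_cons_big v σ (by omega) (H.top n le_rfl (by omega))
    (fun w hw h => (H.dec w hw).2 (by have := H.hd; omega))
  have := H.hd
  have := H.hn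
  refine ⟨by omega, ?_, ?_, ?_, Or.inr ⟨by omega, v, by omega, ?_, ?_, ?_⟩⟩
  · intro w hw
    rw [dec_cons]
    have h2 := H.dec (w - 1)
    grind
  · intro w hw h
    rw [hS, Finset.mem_insert]
    have h1 := H.top w
    grind
  · rw [hS, card_big, H.card]; ring
  · rw [inc_cons]
    exact Or.inl ⟨rfl, inc_top σ (by omega)⟩
  · rw [hS, Finset.mem_insert]
    exact Or.inr (H.top _ (by omega) (by omega))
  · intro w hw hi
    rw [inc_cons] at hi
    omega

theorem IsD.child_lt {n : ℕ} {σ : Equiv.Perm (Fin n)} {d r : ℕ} (H : IsD σ d r)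
    (v : Fin (n + 1)) (hv : (v : ℕ) + 1 < n) : IsD (consP v σ) (min (n - v) d) 0 := by
  have := H.hd
  have := H.hn
  have hi : ¬ IncP σ v := by
    rw [H.inc v (by omega)]; omega
  have hS : S (consP v σ) = Finset.Icc (n + 1 - min (n - v) d) (n + 1) := by
    ext w
    rw [mem_S_cons, Finset.mem_Icc]
    have h2 := H.dec (w - 1)
    grind
  refine ⟨by omega, by omega, ?_, ?_, ?_, ?_⟩
  · intro w hw
    rw [dec_cons]
    have h2 := H.dec (w - 1)
    grind
  · intro w hw
    rw [inc_cons]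
    have h2 := H.inc (w - 1)
    grind
  · intro w hw h
    rw [hS, Finset.mem_Icc]
    omega
  · rw [hS, Nat.card_Icc]; omega

theorem IsT.child_n {n : ℕ} {σ : Equiv.Perm (Fin n)} {r : ℕ} (H : IsT σ r)
    (v : Fin (n + 1)) (hv : (v : ℕ) = n) : IsD (consP v σ) 2 r := by
  have hS := S_cons_big v σ (by omega) (H.top n le_rfl (by omega))
    (fun w hw h => (H.dec w hw).2 h)
  have := H.hn
  refine ⟨by omega, by omega, ?_, ?_, ?_, ?_⟩
  · intro w hw
    rw [dec_cons]
    have h1 := H.dec w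
    have h2 := H.dec (w - 1)
    grind
  · intro w hw
    rw [inc_cons]
    have h1 : IncP σ v := inc_top σ (by omega)
    have h2 : n ≤ (w - 1) + 1 → IncP σ (w - 1) := inc_top σ
    grind
  · intro w hw h
    rw [hS, Finset.mem_insert]
    have h1 := H.top w
    grind
  · rw [hS, card_big, H.card]; ring

theorem IsT.child_n1 {n : ℕ} {σ : Equiv.Perm (Fin n)} {r : ℕ} (H : IsT σ r)
    (v : Fin (n + 1)) (hv : (v : ℕ) + 1 = n) : IsT (consP v σ) (r + 1) := by
  have hS := S_cons_big v σ (by omega) (H.top n le_rfl (by omega))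
    (fun w hw h => (H.dec w hw).2 h)
  have := H.hn
  refine ⟨by omega, ?_, ?_, ?_, Or.inr ⟨by omega, v, by omega, ?_, ?_, ?_⟩⟩
  · intro w hw
    rw [dec_cons]
    have h2 := H.dec (w - 1)
    grind
  · intro w hw h
    rw [hS, Finset.mem_insert]
    have h1 := H.top w
    grind
  · rw [hS, card_big, H.card]
  · rw [inc_cons]
    exact Or.inl ⟨rfl, inc_top σ (by omega)⟩
  · rw [hS, Finset.mem_insert]
    exact Or.inr (H.top _ (by omega) (by omega))
  · intro w hw hi
    rw [inc_cons] at hi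
    omega

theorem IsT.child_w0 {n : ℕ} {σ : Equiv.Perm (Fin n)} {r : ℕ} (H : IsT σ r) (hr : 1 ≤ r)
    (v : Fin (n + 1)) (hv : (v : ℕ) + 1 < n) (hi : IncP σ v) (hm : (v : ℕ) ∈ S σ)
    (hu : ∀ w ∈ S σ, IncP σ w → n ≤ w + 1 ∨ w = v) : IsT (consP v σ) r := by
  have hS : S (consP v σ) = insert (n + 1) ((S σ).erase (n - 1)) := by
    ext w
    rw [mem_S_cons, Finset.mem_insert, Finset.mem_erase]
    have h1 := H.dec (w - 1)
    have h2 := H.top w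
    constructor
    · rintro (⟨h3, _, h⟩ | ⟨h3, h4, h5⟩)
      · exact Or.inr ⟨by omega, h⟩
      · rw [h1 (by omega)] at h5
        by_cases hw : w = n + 1
        · exact Or.inl hw
        · exact Or.inr ⟨by omega, h2 (by omega) (by omega)⟩
    · rintro (h3 | ⟨h3, h4⟩)
      · exact Or.inr ⟨by omega, by omega, (h1 (by omega)).2 (by omega)⟩
      · have := S_le h4
        by_cases hw : w ≤ v
        · exact Or.inl ⟨hw, hi, h4⟩
        · have := hu w h4 (inc_mono σ (by omega) hi)
          exact Or.inr ⟨by omega, by omega, (h1 (by omega)).2 (by omega)⟩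
  refine ⟨by omega, ?_, ?_, ?_, Or.inr ⟨hr, v, by omega, ?_, ?_, ?_⟩⟩
  · intro w hw
    rw [dec_cons]
    have h2 := H.dec (w - 1)
    grind
  · intro w hw h
    rw [hS, Finset.mem_insert, Finset.mem_erase]
    have h1 := H.top w
    grind
  · rw [hS, Finset.card_insert_of_notMem, Finset.card_erase_of_mem, H.card]
    · omega
    · exact H.top _ (by omega) (by omega)
    · intro h
      have := S_le (Finset.mem_of_mem_erase h)
      omega
  · rw [inc_cons]
    exact Or.inl ⟨rfl, hi⟩
  · rw [hS, Finset.mem_insert, Finset.mem_erase]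
    exact Or.inr ⟨by omega, hm⟩
  · intro w hw hi
    rw [hS, Finset.mem_insert, Finset.mem_erase] at hw
    rw [inc_cons] at hi
    rcases hw with hw | ⟨hw1, hw2⟩
    · omega
    · rcases hi with hi | ⟨hi1, hi2⟩
      · exact Or.inr hi.1
      · have := hu w hw2 (inc_mono σ (by omega) hi2)
        omega

theorem IsT.child_lt {n : ℕ} {σ : Equiv.Perm (Fin n)} {r : ℕ} (H : IsT σ r)
    (v : Fin (n + 1)) (hv : (v : ℕ) + 1 < n) (hi : ¬ IncP σ v) : IsT (consP v σ) 0 := by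
  have hS : S (consP v σ) = Finset.Icc n (n + 1) := by
    ext w
    rw [mem_S_cons, Finset.mem_Icc]
    have h2 := H.dec (w - 1)
    grind
  refine ⟨by omega, ?_, ?_, ?_, Or.inl ⟨rfl, ?_⟩⟩
  · intro w hw
    rw [dec_cons]
    have h2 := H.dec (w - 1)
    grind
  · intro w hw h
    rw [hS, Finset.mem_Icc]
    omega
  · rw [hS, Nat.card_Icc]; omega
  · intro w hw
    rw [hS, Finset.mem_Icc] at hw
    omega

theorem main_count (fT : ℕ → ℕ → ℤ) (fD : ℕ → ℕ → ℕ → ℤ)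
    (hT0 : ∀ r, fT r 0 = 1) (hD0 : ∀ d r, 2 ≤ d → fD d r 0 = 1)
    (hT : ∀ r m, fT r (m + 1) = fD 2 r m + fT (r + 1) m + fT r m + ((r : ℤ) - 1) * fT 0 m)
    (hD : ∀ d r m, 2 ≤ d → fD d r (m + 1) = fD (d + 1) r m + fT (d + r) m +
      ∑ t ∈ Finset.Ico 2 (d + 1), fD t 0 m + r * fD d 0 m) (m : ℕ) :
    (∀ (n : ℕ) (σ : Equiv.Perm (Fin n)) (r : ℕ), IsT σ r → (ext m σ : ℤ) = fT r m) ∧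
    (∀ (n : ℕ) (σ : Equiv.Perm (Fin n)) (d r : ℕ), IsD σ d r → (ext m σ : ℤ) = fD d r m) := by
  induction m with
  | zero =>
    refine ⟨fun n σ r _ => ?_, fun n σ d r H => ?_⟩
    · simp [ext, hT0]
    · simp [ext, hD0 d r H.hd]
  | succ m ih =>
    obtain ⟨ihT, ihD⟩ := ih
    refine ⟨fun n σ r H => ?_, fun n σ d r H => ?_⟩
    · have hn := H.hn
      have hnS := H.top n le_rfl (by omega)
      have hn1S := H.top (n - 1) (by omega) (by omega)
      rcases H.alt with ⟨rfl, h⟩ | ⟨hr, w0, hw0, hi, hm, hu⟩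
      · rw [ext_succ σ m (fun v => if v = n then fD 2 0 m else fT 1 m)]
        · have : S σ = {n, n - 1} := by
            ext w
            simp only [Finset.mem_insert, Finset.mem_singleton]
            constructor
            · intro hw
              have := h w hw
              have := S_le hw
              omega
            · rintro (rfl | rfl) <;> assumption
          rw [this, Finset.sum_pair (by omega), hT, if_pos rfl, if_neg (by omega)]
          simp
        · intro v hv
          have := v.2
          have := h v ((mem_S _ _).2 ⟨by omega, hv⟩)
          by_cases hvn : (v : ℕ) = n
          · rw [if_pos hvn, ihD _ _ _ _ (H.child_n v hvn)]
          · rw [if_neg hvn, ihT _ _ _ (H.child_n1 v (by omega))]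
      · rw [ext_succ σ m (fun v => (if v = n then fD 2 r m - fT 0 m else 0) +
          (if v = n - 1 then fT (r + 1) m - fT 0 m else 0) +
          (if v = w0 then fT r m - fT 0 m else 0) + fT 0 m)]
        · simp only [Finset.sum_add_distrib, Finset.sum_ite_eq', hnS, hn1S, hm, if_true, hT,
            Finset.sum_const, H.card]
          simp
          ring
        · intro v hv
          have := v.2
          have hvS := (mem_S _ _).2 ⟨(by omega : (v : ℕ) ≤ n), hv⟩
          by_cases hvn : (v : ℕ) = n
          · rw [if_pos hvn, if_neg (by omega), if_neg (by omega),
              ihD _ _ _ _ (H.child_n v hvn)]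
            ring
          by_cases hvn1 : (v : ℕ) = n - 1
          · rw [if_neg hvn, if_pos hvn1, if_neg (by omega),
              ihT _ _ _ (H.child_n1 v (by omega))]
            ring
          by_cases hvw : (v : ℕ) = w0
          · subst hvw
            rw [if_neg hvn, if_neg hvn1, if_pos rfl,
              ihT _ _ _ (H.child_w0 hr v hw0 hi hm hu)]
            ring
          · rw [if_neg hvn, if_neg hvn1, if_neg hvw, ihT _ _ _ (H.child_lt v (by omega) ?_)]
            · ring
            · intro hiv
              have := hu v hvS hiv
              omega
    · have hn := H.hn
      have hd := H.hd
      rw [ext_succ σ m (fun v => if v = n then fD (d + 1) r m else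
        if v + 1 = n then fT (d + r) m else fD (min (n - v) d) 0 m)]
      · have hsub : Finset.Ico (n - d) (n + 1) ⊆ S σ := by
          intro w hw
          rw [Finset.mem_Ico] at hw
          exact H.top w (by omega) (by omega)
        rw [← Finset.sum_sdiff hsub, hD d r m hd]
        have h1 : ∀ v ∈ S σ \ Finset.Ico (n - d) (n + 1),
            (if v = n then fD (d + 1) r m else
              if v + 1 = n then fT (d + r) m else fD (min (n - v) d) 0 m) = fD d 0 m := by
          intro v hv
          rw [Finset.mem_sdiff, Finset.mem_Ico] at hv
          have := S_le hv.1
          rw [if_neg (by omega), if_neg (by omega), min_eq_right (by omega)]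
        rw [Finset.sum_congr rfl h1, Finset.sum_const, Finset.card_sdiff_of_subset hsub, H.card,
          Nat.card_Ico, show d + 1 + r - (n + 1 - (n - d)) = r by omega]
        obtain ⟨q, rfl⟩ : ∃ q, n = q + 1 := ⟨n - 1, by omega⟩
        rw [Finset.sum_Ico_succ_top (by omega), Finset.sum_Ico_succ_top (by omega), if_pos rfl,
          if_neg (by omega), if_pos rfl]
        have h2 : ∀ v ∈ Finset.Ico (q + 1 - d) q,
            (if v = q + 1 then fD (d + 1) r m else
              if v + 1 = q + 1 then fT (d + r) m else fD (min (q + 1 - v) d) 0 m)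
              = fD (q + 1 - v) 0 m := by
          intro v hv
          rw [Finset.mem_Ico] at hv
          rw [if_neg (by omega), if_neg (by omega), min_eq_left (by omega)]
        rw [Finset.sum_congr rfl h2, Finset.sum_Ico_reflect (fun t => fD t 0 m) _ (by omega),
          show q + 1 + 1 - q = 2 by omega, show q + 1 + 1 - (q + 1 - d) = d + 1 by omega]
        simp only [nsmul_eq_mul]
        ring
      · intro v hv
        have := v.2
        by_cases hvn : (v : ℕ) = n
        · rw [if_pos hvn, ihD _ _ _ _ (H.child_n v hvn)]
        by_cases hvn1 : (v : ℕ) + 1 = n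
        · rw [if_neg hvn, if_pos hvn1, ihT _ _ _ (H.child_n1 v (by omega))]
        · rw [if_neg hvn, if_neg hvn1, ihD _ _ _ _ (H.child_lt v (by omega))]

theorem isT_one (σ : Equiv.Perm (Fin 1)) : IsT σ 0 := by
  have hA : ∀ w, Act σ w :=
    fun w => ⟨fun i j k h => by omega, fun i j k h => by omega⟩
  have hS : S σ = Finset.range 2 := by
    ext w
    rw [mem_S, Finset.mem_range]
    simp only [hA, and_true]; omega
  refine ⟨le_rfl, fun w _ => ⟨fun _ => by omega, fun _ i j h => by omega⟩, ?_, ?_,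
    Or.inl ⟨rfl, fun w _ => by omega⟩⟩
  · intro w hw _
    rw [hS, Finset.mem_range]; omega
  · rw [hS]; rfl

theorem u_zero : u 0 = 1 := by
  rw [u_eq' 0 0 rfl 1]; rfl

theorem u_succ (m : ℕ) : u (m + 1) = ext m (1 : Equiv.Perm (Fin 1)) := by
  rw [u_eq' (m + 1) 0 rfl 1, ext]
  have hA : Act (1 : Equiv.Perm (Fin 0)) ((0 : Fin 1) : ℕ) :=
    ⟨fun i => i.elim0, fun i => i.elim0⟩
  rw [Fin.sum_univ_one, if_pos hA]
  congr 1
  ext i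
  omega

end Sol

open PowerSeries in
theorem stmt1 :
    let F : ℤ⟦X⟧ := PowerSeries.mk fun n => (u n : ℤ)
    let C : ℤ⟦X⟧ := PowerSeries.mk fun n => (catalan n : ℤ)
    (1 - X) * (1 - X * C ^ 3) * F = (1 - X) * (1 - X * C ^ 3) + X := by
  intro F C
  have hC : C = 1 + X * C ^ 2 := by
    have h := congrArg (PowerSeries.map (Nat.castRingHom ℤ)) catalanSeries_sq_mul_X_add_one
    have hc : PowerSeries.map (Nat.castRingHom ℤ) catalanSeries = C := by
      ext n; simp [C]
    simp only [map_add, map_mul, map_pow, map_one, hc, PowerSeries.map_X] at h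
    linear_combination -h
  obtain ⟨P, hP⟩ : ∃ P : ℤ⟦X⟧, (1 - X * C ^ 3) * P = 1 :=
    ⟨invOfUnit (1 - X * C ^ 3) 1, mul_invOfUnit _ _ (by simp)⟩
  obtain ⟨Q, hQ⟩ : ∃ Q : ℤ⟦X⟧, (1 - X) * Q = 1 :=
    ⟨invOfUnit (1 - X) 1, mul_invOfUnit _ _ (by simp)⟩
  set τ := Q * P with hτ
  set b := C * P - 1 - X * Q * P with hb
  let T : ℕ → ℤ⟦X⟧ := fun r => τ + (r : ℤ⟦X⟧) * b
  let D : ℕ → ℕ → ℤ⟦X⟧ := fun d r => P * C ^ (d + 1) - b + (r : ℤ⟦X⟧) * (X * P * C ^ (d + 2))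
  have e1 : τ * (1 - X) = 1 + X * P * C ^ 3 := by
    rw [hτ]; linear_combination P * hQ + hP
  have e2 : b * (1 - 2 * X) = X * (X * P * C ^ 4 + τ) := by
    have hP' : P * (1 + C - C ^ 2) = 1 := by linear_combination hP - P * C * hC
    rw [hb, hτ]
    linear_combination (-2 * X * P) * hQ + P * (C - 1 + X * C ^ 2) * hC + (1 - 2 * X) * hP'
      + 2 * P * hC
  have hTrec : ∀ r, T r = 1 + X * (D 2 r + T (r + 1) + T r + ((r : ℤ⟦X⟧) - 1) * T 0) := by
    intro r
    simp only [T, D]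
    push_cast
    linear_combination e1 + r * e2
  have hsum : ∀ d, 2 ≤ d → X * ∑ t ∈ Finset.Ico 2 (d + 1), D t 0 =
      D d 0 - 1 - X * (D (d + 1) 0 + T d) := by
    intro d hd
    induction d, hd using Nat.le_induction with
    | base =>
      rw [show (2 : ℕ) + 1 = 3 by rfl, Finset.sum_Ico_succ_top (by omega)]
      simp only [T, D, Finset.Ico_self, Finset.sum_empty]
      push_cast
      linear_combination hb + X * hτ + (-P * C - P * C ^ 2) * hC
    | succ d hd ih =>
      rw [Finset.sum_Ico_succ_top (by omega), mul_add, ih]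
      simp only [T, D]
      push_cast
      linear_combination (-P * C ^ (d + 1)) * hC
  have hDrec : ∀ d r, 2 ≤ d → D d r = 1 + X * (D (d + 1) r + T (d + r) +
      ∑ t ∈ Finset.Ico 2 (d + 1), D t 0 + (r : ℤ⟦X⟧) * D d 0) := by
    intro d r hd
    have := hsum d hd
    rw [mul_add, mul_add, this]
    simp only [T, D]
    push_cast
    linear_combination (r * X * P * C ^ (d + 1)) * hC
  have hnat : ∀ (m r : ℕ) (f : ℤ⟦X⟧), coeff m ((r : ℤ⟦X⟧) * f) = (r : ℤ) * coeff m f := by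
    intro m r f
    rw [← nsmul_eq_mul, map_nsmul, nsmul_eq_mul]
  have hT0 : T 0 = τ := by simp [T]
  clear_value T D
  have key := fun m => (Sol.main_count (fun r m => coeff m (T r)) (fun d r m => coeff m (D d r))
    (fun r => by rw [hTrec]; simp)
    (fun d r hd => by rw [hDrec d r hd]; simp)
    (fun r m => by
      have h := congrArg (coeff (m + 1)) (hTrec r)
      rw [map_add, coeff_succ_X_mul, coeff_one, if_neg (by omega), zero_add] at h
      rw [h]
      simp only [map_add, sub_mul, map_sub, hnat, one_mul])
    (fun d r m hd => by
      rw [hDrec d r hd, map_add, coeff_succ_X_mul, coeff_one, if_neg (by omega), zero_add]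
      simp only [map_add, map_sum]
      rw [hnat]) m).1 1 1 0 (Sol.isT_one 1)
  have hF : F = 1 + X * τ := by
    ext m
    cases m with
    | zero => simp [F, Sol.u_zero]
    | succ m =>
      rw [map_add, coeff_succ_X_mul, coeff_one, if_neg (by omega), zero_add]
      simp only [F, coeff_mk, Sol.u_succ, key, hT0]
  rw [hF, hτ]
  linear_combination X * (1 - X) * Q * hP + X * hQ
end

section
/- Let A_{n,k,j} denote the set of start-small permutations of [n] avoiding 1243 and 2134 that have exactly k key mid-123 entries and whose last mid-123 entry occupies position j, and let A_{m,k} denote the set of start-small permutations of [m] avoiding 1243 and 2134 with exactly k key mid-123 entries. Then for all integers n, k, j with 1 ≤ k < j ≤ n−1, the cardinality of A_{n,k,j} equals |A_{j,k−1}| · |A_{n+1−j,0}|; i.e., there is a bijection A_{n,k,j} → A_{j,k−1} × A_{n+1−j,0}. -/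
/-- `π j` is a mid-123 entry: it serves as the "2" of a 123 pattern. -/
def IsMid123 {n : ℕ} (π : Equiv.Perm (Fin n)) (j : Fin n) : Prop :=
  ∃ i k : Fin n, i < j ∧ j < k ∧ π i < π j ∧ π j < π k

/-- `π m` is a right-to-left maximum: it exceeds every entry to its right. -/
def IsRLMax {n : ℕ} (π : Equiv.Perm (Fin n)) (m : Fin n) : Prop :=
  ∀ m' : Fin n, m < m' → π m' < π m

/-- `π j` is a key mid-123 entry: a mid-123 entry whose immediate predecessor either is
smaller than `π j` or is a right-to-left maximum. -/
def IsKeyMid123 {n : ℕ} (π : Equiv.Perm (Fin n)) (j : Fin n) : Prop :=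
  IsMid123 π j ∧ ∃ j' : Fin n, (j' : ℕ) + 1 = (j : ℕ) ∧ (π j' < π j ∨ IsRLMax π j')

/-- `π` is start-small: it does not start with its largest entry `n`. -/
def StartSmall {n : ℕ} (π : Equiv.Perm (Fin n)) : Prop :=
  ∀ h : 0 < n, ((π ⟨0, h⟩ : ℕ)) + 1 ≠ n

/-- The number of key mid-123 entries of `π`. -/
noncomputable def keyCount {n : ℕ} (π : Equiv.Perm (Fin n)) : ℕ :=
  Nat.card {j : Fin n // IsKeyMid123 π j}

/-- `A n k` : start-small permutations of `[n]` avoiding 1243 and 2134 with exactly `k`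
key mid-123 entries. -/
def A (n k : ℕ) : Set (Equiv.Perm (Fin n)) :=
  {π | StartSmall π ∧ AvoidsBoth π ∧ keyCount π = k}

/-- `Apos n k j` : members of `A n k` whose last mid-123 entry is in (1-based) position `j`. -/
def Apos (n k j : ℕ) : Set (Equiv.Perm (Fin n)) :=
  {π | π ∈ A n k ∧ ∃ jf : Fin n, (jf : ℕ) + 1 = j ∧ IsMid123 π jf ∧
    ∀ j' : Fin n, jf < j' → ¬ IsMid123 π j'}


namespace St

def sq {n : ℕ} (π : Equiv.Perm (Fin n)) : ℕ → ℕ := fun i => if h : i < n then (π ⟨i, h⟩ : ℕ) else 0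

def OE (n : ℕ) (f g : ℕ → ℕ) : Prop := ∀ i k, i < n → k < n → (f i < f k ↔ g i < g k)

def Inj (n : ℕ) (f : ℕ → ℕ) : Prop := ∀ i k, i < n → k < n → f i = f k → i = k

def Av1 (n : ℕ) (f : ℕ → ℕ) : Prop :=
  ∀ i j k l, i < j → j < k → k < l → l < n → f i < f j → f j < f l → f l < f k → False

def Av2 (n : ℕ) (f : ℕ → ℕ) : Prop :=
  ∀ i j k l, i < j → j < k → k < l → l < n → f j < f i → f i < f k → f k < f l → False

def Mid (n : ℕ) (f : ℕ → ℕ) (j : ℕ) : Prop := ∃ i k, i < j ∧ j < k ∧ k < n ∧ f i < f j ∧ f j < f k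

def RLM (n : ℕ) (f : ℕ → ℕ) (m : ℕ) : Prop := ∀ m', m < m' → m' < n → f m' < f m

def Key (n : ℕ) (f : ℕ → ℕ) (j : ℕ) : Prop :=
  Mid n f j ∧ (f (j - 1) < f j ∨ RLM n f (j - 1))

def SS (n : ℕ) (f : ℕ → ℕ) : Prop := ∃ i, i < n ∧ f 0 < f i

open Classical in
noncomputable def kc (n : ℕ) (f : ℕ → ℕ) : ℕ := ((Finset.range n).filter (Key n f)).card

def Good (n k : ℕ) (f : ℕ → ℕ) : Prop := SS n f ∧ Av1 n f ∧ Av2 n f ∧ kc n f = k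

theorem OE.symm {n f g} (h : OE n f g) : OE n g f := fun i k hi hk => (h i k hi hk).symm
theorem OE.trans {n f g l} (h : OE n f g) (h' : OE n g l) : OE n f l :=
  fun i k hi hk => (h i k hi hk).trans (h' i k hi hk)

theorem OE.inj {n f g} (h : OE n f g) (hf : Inj n f) : Inj n g := by
  intro i k hi hk e
  apply hf i k hi hk
  have h1 := h i k hi hk
  have h2 := h k i hk hi
  omega

theorem OE.av1 {n f g} (h : OE n f g) (hf : Av1 n f) : Av1 n g := by
  intro i j k l h1 h2 h3 h4 h5 h6 h7
  exact hf i j k l h1 h2 h3 h4 ((h _ _ (by omega) (by omega)).2 h5)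
    ((h _ _ (by omega) (by omega)).2 h6) ((h _ _ (by omega) (by omega)).2 h7)

theorem OE.av2 {n f g} (h : OE n f g) (hf : Av2 n f) : Av2 n g := by
  intro i j k l h1 h2 h3 h4 h5 h6 h7
  exact hf i j k l h1 h2 h3 h4 ((h _ _ (by omega) (by omega)).2 h5)
    ((h _ _ (by omega) (by omega)).2 h6) ((h _ _ (by omega) (by omega)).2 h7)

theorem OE.mid {n f g j} (h : OE n f g) (hf : Mid n f j) : Mid n g j := by
  obtain ⟨i, k, h1, h2, h3, h4, h5⟩ := hf
  exact ⟨i, k, h1, h2, h3, (h _ _ (by omega) (by omega)).1 h4, (h _ _ (by omega) (by omega)).1 h5⟩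

theorem OE.rlm {n f g j} (h : OE n f g) (hj : j < n) (hf : RLM n f j) : RLM n g j := by
  intro m h1 h2
  exact (h _ _ (by omega) (by omega)).1 (hf m h1 h2)

theorem OE.key {n f g j} (h : OE n f g) (hf : Key n f j) : Key n g j := by
  refine ⟨h.mid hf.1, ?_⟩
  obtain ⟨⟨i, k, h1, h2, h3, h4, h5⟩, h6⟩ := hf
  rcases h6 with h6 | h6
  · exact Or.inl ((h _ _ (by omega) (by omega)).1 h6)
  · exact Or.inr (h.rlm (by omega) h6)

theorem OE.ss {n f g} (h : OE n f g) (hf : SS n f) : SS n g := by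
  obtain ⟨i, h1, h2⟩ := hf
  exact ⟨i, h1, (h _ _ (by omega) (by omega)).1 h2⟩

theorem OE.kc {n f g} (h : OE n f g) : kc n f = kc n g := by
  unfold St.kc
  congr 1
  ext j
  simp only [Finset.mem_filter]
  exact ⟨fun ⟨a, b⟩ => ⟨a, h.key b⟩, fun ⟨a, b⟩ => ⟨a, h.symm.key b⟩⟩

theorem OE.good {n k f g} (h : OE n f g) (hf : Good n k f) : Good n k g :=
  ⟨h.ss hf.1, h.av1 hf.2.1, h.av2 hf.2.2.1, h.kc ▸ hf.2.2.2⟩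

theorem sq_fin {n} (π : Equiv.Perm (Fin n)) (i : Fin n) : sq π i = π i := by
  simp [sq]

theorem sq_mk {n} (π : Equiv.Perm (Fin n)) (i : ℕ) (h : i < n) : sq π i = π ⟨i, h⟩ := by
  simp [sq, h]

theorem sq_lt {n} (π : Equiv.Perm (Fin n)) (i : ℕ) (h : i < n) : sq π i < n := by
  simp [sq, h]

theorem sq_inj {n} (π : Equiv.Perm (Fin n)) : Inj n (sq π) := by
  intro i k hi hk h
  rw [sq_mk _ _ hi, sq_mk _ _ hk] at h
  have := π.injective (Fin.ext h)
  simpa using this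

theorem exists_perm {n f} (hf : Inj n f) : ∃ π : Equiv.Perm (Fin n), OE n (sq π) f := by
  let g : Fin n → ℕ := fun i => f i
  have hg : Function.Injective g := fun a b h => Fin.ext (hf a b a.2 b.2 h)
  have hm : StrictMono (g ∘ Tuple.sort g) :=
    (Tuple.monotone_sort g).strictMono_of_injective (hg.comp (Tuple.sort g).injective)
  refine ⟨(Tuple.sort g)⁻¹, ?_⟩
  intro i k hi hk
  rw [sq_mk _ _ hi, sq_mk _ _ hk]
  have := hm.lt_iff_lt (a := (Tuple.sort g)⁻¹ ⟨i, hi⟩) (b := (Tuple.sort g)⁻¹ ⟨k, hk⟩)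
  simp only [Function.comp, Equiv.Perm.coe_inv, Equiv.apply_symm_apply] at this
  rw [← Fin.lt_def, Equiv.Perm.coe_inv, ← this]

theorem perm_eq {n} {π σ : Equiv.Perm (Fin n)} (h : OE n (sq π) (sq σ)) : π = σ := by
  have hs : StrictMono (fun x => σ (π⁻¹ x)) := by
    intro a b hab
    have := (h (π⁻¹ a) (π⁻¹ b) (π⁻¹ a).2 (π⁻¹ b).2).1
    simp only [sq_fin, Equiv.Perm.coe_inv, Equiv.apply_symm_apply] at this
    exact this hab
  let e : Fin n ≃o Fin n := hs.orderIsoOfSurjective _ ((π⁻¹).trans σ).surjective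
  have : e = OrderIso.refl _ := Subsingleton.elim _ _
  ext i
  have h2 := congrArg (fun e => e (π i)) this
  simp [e] at h2
  rw [h2]

theorem mid_iff {n} (π : Equiv.Perm (Fin n)) (j : Fin n) : IsMid123 π j ↔ Mid n (sq π) j := by
  constructor
  · rintro ⟨i, k, h1, h2, h3, h4⟩
    exact ⟨i, k, h1, h2, k.2, by simpa [sq_fin] using h3, by simpa [sq_fin] using h4⟩
  · rintro ⟨i, k, h1, h2, h3, h4, h5⟩
    refine ⟨⟨i, by omega⟩, ⟨k, h3⟩, h1, h2, ?_, ?_⟩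
    · rw [sq_fin, sq_mk _ _ (by omega)] at h4; exact h4
    · rw [sq_fin, sq_mk _ _ (by omega)] at h5; exact h5

theorem rlm_iff {n} (π : Equiv.Perm (Fin n)) (j : Fin n) : IsRLMax π j ↔ RLM n (sq π) j := by
  constructor
  · intro h m h1 h2
    have := h ⟨m, h2⟩ h1
    rw [sq_fin, sq_mk _ _ h2]; exact this
  · intro h m h1
    have := h m h1 m.2
    rw [sq_fin, sq_fin] at this; exact this

theorem key_iff {n} (π : Equiv.Perm (Fin n)) (j : Fin n) : IsKeyMid123 π j ↔ Key n (sq π) j := by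
  unfold IsKeyMid123 Key
  rw [mid_iff]
  apply and_congr_right
  intro hm
  have hj : 0 < (j : ℕ) := by obtain ⟨i, k, h1, _⟩ := hm; omega
  constructor
  · rintro ⟨j', h1, h2⟩
    have : (j : ℕ) - 1 = j' := by omega
    rw [this, ← rlm_iff, sq_fin, sq_fin]; exact h2
  · intro h
    refine ⟨⟨j - 1, by omega⟩, by simp; omega, ?_⟩
    rw [rlm_iff, Fin.lt_def, ← sq_fin, ← sq_fin]; exact h

theorem kc_eq {n} (π : Equiv.Perm (Fin n)) : keyCount π = kc n (sq π) := by
  classical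
  unfold keyCount kc
  rw [Nat.card_eq_fintype_card, Fintype.card_subtype]
  apply Finset.card_bij (fun (a : Fin n) _ => (a : ℕ))
  · intro a ha
    simp only [Finset.mem_filter, Finset.mem_univ, true_and] at ha
    simp only [Finset.mem_filter, Finset.mem_range]
    exact ⟨a.2, (key_iff π a).1 ha⟩
  · intro a _ b _ h
    exact Fin.ext h
  · intro b hb
    simp only [Finset.mem_filter, Finset.mem_range] at hb
    refine ⟨⟨b, hb.1⟩, ?_, rfl⟩
    simp only [Finset.mem_filter, Finset.mem_univ, true_and]
    exact (key_iff π _).2 hb.2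

theorem av1_iff {n} (π : Equiv.Perm (Fin n)) : ¬ Contains1243 π ↔ Av1 n (sq π) := by
  constructor
  · intro h i j k l h1 h2 h3 h4 h5 h6 h7
    rw [sq_mk _ _ (by omega), sq_mk _ _ (by omega)] at h5 h6 h7
    exact h ⟨⟨i, by omega⟩, ⟨j, by omega⟩, ⟨k, by omega⟩, ⟨l, by omega⟩, h1, h2, h3, h5, h6, h7⟩
  · rintro h ⟨i, j, k, l, h1, h2, h3, h5, h6, h7⟩
    exact h i j k l h1 h2 h3 l.2 (by simpa [sq_fin] using h5) (by simpa [sq_fin] using h6)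
      (by simpa [sq_fin] using h7)

theorem av2_iff {n} (π : Equiv.Perm (Fin n)) : ¬ Contains2134 π ↔ Av2 n (sq π) := by
  constructor
  · intro h i j k l h1 h2 h3 h4 h5 h6 h7
    rw [sq_mk _ _ (by omega), sq_mk _ _ (by omega)] at h5 h6 h7
    exact h ⟨⟨i, by omega⟩, ⟨j, by omega⟩, ⟨k, by omega⟩, ⟨l, by omega⟩, h1, h2, h3, h5, h6, h7⟩
  · rintro h ⟨i, j, k, l, h1, h2, h3, h5, h6, h7⟩
    exact h i j k l h1 h2 h3 l.2 (by simpa [sq_fin] using h5) (by simpa [sq_fin] using h6)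
      (by simpa [sq_fin] using h7)

theorem ss_iff {n} (hn : 1 ≤ n) (π : Equiv.Perm (Fin n)) : StartSmall π ↔ SS n (sq π) := by
  constructor
  · intro h
    have h0 := h hn
    refine ⟨π⁻¹ ⟨n - 1, by omega⟩, Fin.is_lt _, ?_⟩
    rw [sq_fin, sq_mk _ _ hn]
    simp only [Equiv.Perm.coe_inv, Equiv.apply_symm_apply]
    have := (π ⟨0, hn⟩).2
    omega
  · rintro ⟨i, h1, h2⟩ h
    have := sq_lt π i h1
    rw [sq_mk _ _ hn] at h2
    omega

theorem mem_A {n k} (hn : 1 ≤ n) (π : Equiv.Perm (Fin n)) : π ∈ A n k ↔ Good n k (sq π) := by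
  unfold A AvoidsBoth Good
  rw [Set.mem_ofPred_eq, ss_iff hn, av1_iff, av2_iff, kc_eq, and_assoc]

def GoodP (n k J : ℕ) (f : ℕ → ℕ) : Prop :=
  Good n k f ∧ Mid n f J ∧ ∀ i, J < i → ¬ Mid n f i

theorem OE.goodP {n k J f g} (h : OE n f g) (hf : GoodP n k J f) : GoodP n k J g :=
  ⟨h.good hf.1, h.mid hf.2.1, fun i hi hm => hf.2.2 i hi (h.symm.mid hm)⟩

theorem mem_Apos {n k J} (hn : 1 ≤ n) (π : Equiv.Perm (Fin n)) :
    π ∈ Apos n k (J + 1) ↔ GoodP n k J (sq π) := by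
  unfold Apos GoodP
  rw [Set.mem_ofPred_eq, mem_A hn]
  apply and_congr_right
  intro _
  constructor
  · rintro ⟨j, h1, h2, h3⟩
    have : (j : ℕ) = J := by omega
    subst this
    refine ⟨(mid_iff π j).1 h2, ?_⟩
    intro i hi hm
    have hin : i < n := by obtain ⟨_, _, _, _, _, _⟩ := hm; omega
    exact h3 ⟨i, hin⟩ hi ((mid_iff π _).2 hm)
  · rintro ⟨h1, h2⟩
    have hin : J < n := by obtain ⟨_, _, _, _, _, _⟩ := h1; omega
    refine ⟨⟨J, hin⟩, rfl, (mid_iff π _).2 h1, ?_⟩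
    intro j hj hm
    exact h2 j hj ((mid_iff π _).1 hm)

theorem card_rel {α β : Type*} (X : Set α) (Y : Set β) (R : α → β → Prop)
    (h1 : ∀ x ∈ X, ∃ y ∈ Y, R x y) (h2 : ∀ y ∈ Y, ∃ x ∈ X, R x y)
    (h3 : ∀ x ∈ X, ∀ y ∈ Y, ∀ y' ∈ Y, R x y → R x y' → y = y')
    (h4 : ∀ x ∈ X, ∀ x' ∈ X, ∀ y ∈ Y, R x y → R x' y → x = x') : Nat.card X = Nat.card Y := by
  choose F hF using h1
  apply Nat.card_eq_of_bijective (fun x : X => (⟨F x x.2, (hF x x.2).1⟩ : Y))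
  constructor
  · intro a b h
    have h' : F a a.2 = F b b.2 := congrArg Subtype.val h
    apply Subtype.ext
    have := (hF b b.2).2
    rw [← h'] at this
    exact h4 a a.2 b b.2 _ (hF a a.2).1 (hF a a.2).2 this
  · rintro ⟨y, hy⟩
    obtain ⟨x, hx, hR⟩ := h2 y hy
    exact ⟨⟨x, hx⟩, Subtype.ext (h3 x hx _ (hF x hx).1 y hy (hF x hx).2 hR)⟩

theorem kc_zero {n f} (hf : Inj n f) : kc n f = 0 ↔ ∀ i, ¬ Mid n f i := by
  classical
  constructor
  · intro h i hi
    have hex : ∃ i, Mid n f i := ⟨i, hi⟩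
    have hm := Nat.find_spec hex
    have hmin := fun j => Nat.find_min (m := j) hex
    generalize Nat.find hex = p at hm hmin
    unfold kc at h
    rw [Finset.card_eq_zero, Finset.filter_eq_empty_iff] at h
    obtain ⟨a, b, h1, h2, h3, h4, h5⟩ := id hm
    refine h (Finset.mem_range.2 (show p < n by omega)) ⟨hm, ?_⟩
    by_contra hc
    push Not at hc
    obtain ⟨hc1, hc2⟩ := hc
    unfold RLM at hc2
    push Not at hc2
    obtain ⟨q, hq1, hq2, hq3⟩ := hc2
    have hne : f (p - 1) ≠ f q := fun he => by
      have := hf _ _ (by omega) (by omega) he; omega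
    have : a ≠ p - 1 := by rintro rfl; omega
    exact hmin (p - 1) (by omega) ⟨a, q, by omega, hq1, hq2, by omega, by omega⟩
  · intro h
    unfold kc
    rw [Finset.card_eq_zero, Finset.filter_eq_empty_iff]
    intro i _ hk
    exact h i hk.1

end St

namespace St

theorem card_del (n n' : ℕ) (e : ℕ → ℕ) (he : ∀ i, i < n' → e i < n)
    (hei : ∀ i k, i < n' → k < n' → e i = e k → i = k) (Q Q' : (ℕ → ℕ) → Prop)
    (hQ : ∀ f g, OE n f g → Q f → Q g) (hQ' : ∀ f g, OE n' f g → Q' f → Q' g)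
    (h1 : ∀ f, Inj n f → Q f → Q' (f ∘ e))
    (h2 : ∀ g, Inj n' g → Q' g → ∃ f, Inj n f ∧ Q f ∧ OE n' (f ∘ e) g)
    (h3 : ∀ f f', Inj n f → Inj n f' → Q f → Q f' → OE n' (f ∘ e) (f' ∘ e) → OE n f f') :
    Nat.card {π : Equiv.Perm (Fin n) | Q (sq π)} =
      Nat.card {π : Equiv.Perm (Fin n') | Q' (sq π)} := by
  have comp : ∀ f g, OE n f g → OE n' (f ∘ e) (g ∘ e) := fun f g h i k hi hk =>
    h _ _ (he i hi) (he k hk)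
  have compi : ∀ f, Inj n f → Inj n' (f ∘ e) := fun f h i k hi hk h' =>
    hei i k hi hk (h _ _ (he i hi) (he k hk) h')
  apply card_rel _ _ (fun π σ => OE n' (sq π ∘ e) (sq σ))
  · intro π hπ
    obtain ⟨σ, hσ⟩ := exists_perm (compi _ (sq_inj π))
    exact ⟨σ, hQ' _ _ hσ.symm (h1 _ (sq_inj π) hπ), hσ.symm⟩
  · intro σ hσ
    obtain ⟨f, hf, hq, ho⟩ := h2 _ (sq_inj σ) hσ
    obtain ⟨π, hπ⟩ := exists_perm hf
    exact ⟨π, hQ _ _ hπ.symm hq, (comp _ _ hπ).trans ho⟩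
  · intro x _ y _ y' _ h h'
    exact perm_eq (h.symm.trans h')
  · intro x hx x' hx' y _ h h'
    exact perm_eq (h3 _ _ (sq_inj x) (sq_inj x') hx hx' (h.trans h'.symm))

def del (J : ℕ) : ℕ → ℕ := fun i => if i < J then i else i + 1

theorem del_lt {J i} (h : i < J) : del J i = i := by simp [del, h]
theorem del_ge {J i} (h : J ≤ i) : del J i = i + 1 := by simp [del]; omega

theorem del_mono {J i k} (h : i < k) : del J i < del J k := by
  unfold del; split_ifs <;> omega

theorem exists_min (n : ℕ) (f : ℕ → ℕ) : ∃ a, a < n + 1 ∧ ∀ i, i < n + 1 → f a ≤ f i := by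
  obtain ⟨a, h1, h2⟩ := Finset.exists_min_image (Finset.range (n + 1)) f ⟨0, by simp⟩
  exact ⟨a, by simpa using h1, fun i hi => h2 i (by simpa using hi)⟩

theorem kc_sum (n f) [DecidablePred (Key n f)] :
    kc n f = ∑ i ∈ Finset.range n, if Key n f i then 1 else 0 := by
  unfold kc
  rw [Finset.card_filter]
  apply Finset.sum_congr rfl
  intro i _
  congr

theorem mid_lt {n f i} (h : Mid n f i) : 0 < i ∧ i + 1 < n := by
  obtain ⟨a, b, h1, h2, h3, _⟩ := h
  omega

theorem key_del {J f i} (hi : i < J) (hv : f J < f (J + 1)) :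
    Key (J + 2) f i ↔ Key (J + 1) (f ∘ del J) i := by
  have hm : Mid (J + 2) f i ↔ Mid (J + 1) (f ∘ del J) i := by
    constructor
    · rintro ⟨a, b, h1, h2, h3, h4, h5⟩
      by_cases hb : b < J
      · refine ⟨a, b, h1, h2, by omega, ?_, ?_⟩ <;>
          simpa [del_lt hb, del_lt hi, del_lt (h1.trans hi)]
      · refine ⟨a, J, h1, hi, by omega, ?_, ?_⟩
        · simpa [del_lt hi, del_lt (h1.trans hi)]
        · simp only [Function.comp, del_lt hi, del_ge (le_refl J)]
          have : b = J ∨ b = J + 1 := by omega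
          rcases this with rfl | rfl <;> omega
    · rintro ⟨a, b, h1, h2, h3, h4, h5⟩
      simp only [Function.comp, del_lt hi, del_lt (h1.trans hi)] at h4 h5
      refine ⟨a, del J b, h1, ?_, ?_, h4, h5⟩
      · unfold del; split_ifs <;> omega
      · unfold del; split_ifs <;> omega
  unfold Key
  rw [hm]
  apply and_congr_right
  intro hmm
  have h0 := mid_lt hmm
  have hi1 : i - 1 < J := by omega
  simp only [Function.comp, del_lt hi, del_lt hi1]
  have hr : RLM (J + 2) f (i - 1) ↔ RLM (J + 1) (f ∘ del J) (i - 1) := by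
    constructor
    · intro h m h1 h2
      simp only [Function.comp, del_lt hi1]
      apply h <;> (unfold del; split_ifs <;> omega)
    · intro h m h1 h2
      have hh := h J (by omega) (by omega)
      simp only [Function.comp, del_lt hi1, del_ge (le_refl J)] at hh
      by_cases hb : m < J
      · have := h m h1 (by omega)
        simpa [del_lt hi1, del_lt hb] using this
      · have : m = J ∨ m = J + 1 := by omega
        rcases this with rfl | rfl <;> omega
  rw [hr]

open Classical in
theorem kc_del {J f} (hv : f J < f (J + 1)) :
    kc (J + 2) f = kc (J + 1) (f ∘ del J) + if Key (J + 2) f J then 1 else 0 := by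
  rw [kc_sum, kc_sum, Finset.sum_range_succ, Finset.sum_range_succ, Finset.sum_range_succ]
  have h1 : ¬ Key (J + 2) f (J + 1) := fun h => by have := mid_lt h.1; omega
  have h2 : ¬ Key (J + 1) (f ∘ del J) J := fun h => by have := mid_lt h.1; omega
  simp only [h1, h2, if_false, add_zero]
  congr 1
  apply Finset.sum_congr rfl
  intro i hi
  simp only [key_del (Finset.mem_range.1 hi) hv]

theorem goodP_v {J k f} (h : GoodP (J + 2) k J f) : f J < f (J + 1) ∧ ∃ a, a < J ∧ f a < f J := by
  obtain ⟨a, b, h1, h2, h3, h4, h5⟩ := h.2.1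
  have : b = J + 1 := by omega
  subst this
  exact ⟨h5, a, h1, h4⟩

theorem av_del {J f} (h : Av1 (J + 2) f) (h' : Av2 (J + 2) f) :
    Av1 (J + 1) (f ∘ del J) ∧ Av2 (J + 1) (f ∘ del J) := by
  constructor
  · intro i j k l h1 h2 h3 h4
    exact h _ _ _ _ (del_mono h1) (del_mono h2) (del_mono h3) (by unfold del; split_ifs <;> omega)
  · intro i j k l h1 h2 h3 h4
    exact h' _ _ _ _ (del_mono h1) (del_mono h2) (del_mono h3) (by unfold del; split_ifs <;> omega)

theorem ss_del {J f} (hJ : 1 ≤ J) (hv : f J < f (J + 1)) :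
    SS (J + 2) f ↔ SS (J + 1) (f ∘ del J) := by
  have e0 : del J 0 = 0 := del_lt hJ
  constructor
  · rintro ⟨i, h1, h2⟩
    by_cases hi : i < J
    · exact ⟨i, by omega, by simpa [e0, del_lt hi]⟩
    · refine ⟨J, by omega, ?_⟩
      simp only [Function.comp, e0, del_ge (le_refl J)]
      have : i = J ∨ i = J + 1 := by omega
      rcases this with rfl | rfl <;> omega
  · rintro ⟨i, h1, h2⟩
    refine ⟨del J i, by unfold del; split_ifs <;> omega, ?_⟩
    simpa [e0] using h2

/-- the smaller entries before `v` increase -/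
theorem incr {J k f} (h : GoodP (J + 2) k J f) (hf : Inj (J + 2) f) {x y : ℕ} (hxy : x < y)
    (hy : y < J) (h1 : f x < f J) : f x < f y := by
  have hv := (goodP_v h).1
  by_contra hc
  have : f x ≠ f y := fun he => by have := hf _ _ (by omega) (by omega) he; omega
  exact h.1.2.2.1 x y J (J + 1) hxy hy (by omega) (by omega) (by omega) h1 hv

def T2 (J : ℕ) (f : ℕ → ℕ) : Prop := f (J - 1) < f (J + 1) ∧ ∃ a, a < J - 1 ∧ f a < f (J - 1)

/-- location of `v` when only the minimum lies below -/
theorem loc_min {J k f} (h : GoodP (J + 2) k J f) (hf : Inj (J + 2) f) (hJ : 1 ≤ J)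
    (hp : f J < f (J - 1) ∨ ∀ a, a < J → f (J - 1) ≤ f a) (i : ℕ) (hi : i < J) :
    f i < f J ↔ ∀ a, a < J → f i ≤ f a := by
  obtain ⟨hv, a0, ha0, ha1⟩ := goodP_v h
  constructor
  · intro hiv a ha
    by_contra hc
    push Not at hc
    have hai : a < i := by
      by_contra hc2
      have : i ≠ a := by rintro rfl; omega
      have := incr h hf (show i < a by omega) ha hiv
      omega
    rcases hp with hp | hp
    · have : i ≠ J - 1 := by rintro rfl; omega
      exact h.1.2.1 a i (J - 1) J hai (by omega) (by omega) (by omega) hc hiv hp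
    · have h1 := hp a ha
      have : i ≠ J - 1 → f i < f (J - 1) := fun hn => incr h hf (by omega) (by omega) hiv
      have : a < J - 1 → f a < f (J - 1) := fun hn => incr h hf (by omega) (by omega) (by omega)
      omega
  · intro hm
    have := hm a0 ha0
    omega

theorem loc_T2 {J k f} (h : GoodP (J + 2) k J f) (hf : Inj (J + 2) f) (hJ : 1 ≤ J)
    (hp : f (J - 1) < f J) (i : ℕ) (hi : i < J) :
    f i < f J ↔ f i ≤ f (J - 1) := by
  constructor
  · intro hiv
    have : i ≠ J - 1 → f i < f (J - 1) := fun hn => incr h hf (by omega) (by omega) hiv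
    by_cases hn : i = J - 1
    · rw [hn]
    · have := this hn; omega
  · intro; omega

theorem OE_of_loc {J f f'} (hv : f J < f (J + 1)) (hv' : f' J < f' (J + 1))
    (hf : Inj (J + 2) f) (hf' : Inj (J + 2) f')
    (ho : OE (J + 1) (f ∘ del J) (f' ∘ del J))
    (hl : ∀ i, i < J → (f i < f J ↔ f' i < f' J)) : OE (J + 2) f f' := by
  have key : ∀ i k, i ≠ J → k ≠ J → i < J + 2 → k < J + 2 → (f i < f k ↔ f' i < f' k) := by
    intro i k hi hk hi2 hk2
    have h := ho (if i < J then i else i - 1) (if k < J then k else k - 1)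
      (by split_ifs <;> omega) (by split_ifs <;> omega)
    have e : ∀ i, i ≠ J → del J (if i < J then i else i - 1) = i := by
      intro i hi
      unfold del; split_ifs <;> omega
    simpa only [Function.comp, e i hi, e k hk] using h
  have k1 : ∀ i, i ≠ J → i < J + 2 → (f i < f J ↔ f' i < f' J) := by
    intro i h1 h2
    by_cases hi : i < J
    · exact hl i hi
    · have : i = J + 1 := by omega
      subst this; omega
  intro i k hi hk
  by_cases h1 : i = J <;> by_cases h2 : k = J
  · subst h1; subst h2; simp
  · subst h1
    have := k1 k h2 hk
    have n1 : f k ≠ f i := fun he => h2 (hf _ _ hk hi he)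
    have n2 : f' k ≠ f' i := fun he => h2 (hf' _ _ hk hi he)
    omega
  · subst h2; exact k1 i h1 hi
  · exact key i k h1 h2 hi hk

/-- comparison of original entries from the deleted relation -/
theorem OE_del_cmp {J f f'} (ho : OE (J + 1) (f ∘ del J) (f' ∘ del J)) :
    (∀ i k, i < J → k < J → (f i < f k ↔ f' i < f' k)) ∧
    (∀ i, i < J → (f i < f (J + 1) ↔ f' i < f' (J + 1))) := by
  constructor
  · intro i k hi hk
    have := ho i k (by omega) (by omega)
    simpa only [Function.comp, del_lt hi, del_lt hk] using this
  · intro i hi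
    have := ho i J (by omega) (by omega)
    simpa only [Function.comp, del_lt hi, del_ge (le_refl J)] using this

def insf (J c : ℕ) (g : ℕ → ℕ) : ℕ → ℕ := fun i => if i < J then 2 * g i else if i = J then c else 2 * g J

theorem insf_lt {J c g i} (h : i < J) : insf J c g i = 2 * g i := by simp [insf, h]
theorem insf_eq {J c g} : insf J c g J = c := by simp [insf]
theorem insf_gt {J c g} : insf J c g (J + 1) = 2 * g J := by simp [insf]

theorem insf_OE (J c g) : OE (J + 1) (insf J c g ∘ del J) g := by
  have : ∀ i, i < J + 1 → (insf J c g ∘ del J) i = 2 * g i := by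
    intro i hi
    by_cases h : i < J
    · simp [del_lt h, insf_lt h]
    · have : i = J := by omega
      subst this
      simp [del_ge (le_refl i), insf_gt]
  intro i k hi hk
  rw [this i hi, this k hk]; omega

theorem insf_inj {J c g} (hg : Inj (J + 1) g) (hc : c % 2 = 1) : Inj (J + 2) (insf J c g) := by
  have key : ∀ i, i < J + 2 → i < J ∧ insf J c g i = 2 * g i ∨ i = J ∧ insf J c g i = c
      ∨ i = J + 1 ∧ insf J c g i = 2 * g J := by
    intro i hi
    by_cases h : i < J
    · exact Or.inl ⟨h, insf_lt h⟩
    · by_cases h' : i = J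
      · exact Or.inr (Or.inl ⟨h', h' ▸ insf_eq⟩)
      · have : i = J + 1 := by omega
        exact Or.inr (Or.inr ⟨this, this ▸ insf_gt⟩)
  intro i k hi hk he
  have h1 := key i hi
  have h2 := key k hk
  have h3 : i < J + 1 → k < J + 1 → g i = g k → i = k := fun a b c => hg i k a b c
  have h4 : i < J + 1 → g i = g J → i = J := fun a c => hg i J a (by omega) c
  have h5 : k < J + 1 → g k = g J → k = J := fun a c => hg k J a (by omega) c
  rcases h1 with ⟨a, b⟩ | ⟨a, b⟩ | ⟨a, b⟩ <;> rcases h2 with ⟨a', b'⟩ | ⟨a', b'⟩ | ⟨a', b'⟩ <;> omega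

end St

namespace St

theorem insf_av {J c g} (h1 : Av1 (J + 1) g) (h2 : Av2 (J + 1) g) (hg : Inj (J + 1) g)
    (hc : c < 2 * g J)
    (hA : (∀ x y, x < J → y < J → 2 * g x < c → 2 * g y < c → x = y) ∨
      (1 ≤ J ∧ c = 2 * g (J - 1) + 1)) :
    Av1 (J + 2) (insf J c g) ∧ Av2 (J + 2) (insf J c g) := by
  constructor
  · intro x y z w hxy hyz hzw hw f1 f2 f3
    rw [insf_lt (show x < J by omega)] at f1
    by_cases hwJ : w < J
    · rw [insf_lt (by omega)] at f1 f2 f3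
      rw [insf_lt (by omega)] at f2 f3
      exact h1 x y z w hxy hyz hzw (by omega) (by omega) (by omega) (by omega)
    by_cases hwJ : w = J
    · subst hwJ
      rw [insf_eq] at f2 f3
      rw [insf_lt (by omega)] at f1 f2
      rw [insf_lt (by omega)] at f3
      rcases hA with hA | ⟨hJ, hA⟩
      · have := hA x y (by omega) (by omega) (by omega) (by omega); omega
      · have : z ≠ w - 1 := by rintro rfl; omega
        have : g y ≠ g (w - 1) := fun he => by
          have := hg _ _ (by omega) (by omega) he; omega
        exact h1 x y z (w - 1) hxy hyz (by omega) (by omega) (by omega) (by omega) (by omega)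
    · have : w = J + 1 := by omega
      subst this
      rw [insf_gt] at f2 f3
      by_cases hz : z = J
      · subst hz; rw [insf_eq] at f3; omega
      · rw [insf_lt (by omega)] at f1 f2 f3
        exact h1 x y z J hxy hyz (by omega) (by omega) (by omega) (by omega) (by omega)
  · intro x y z w hxy hyz hzw hw f1 f2 f3
    rw [insf_lt (show x < J by omega)] at f1 f2
    rw [insf_lt (show y < J by omega)] at f1
    by_cases hwJ : w < J
    · rw [insf_lt (by omega)] at f2 f3
      rw [insf_lt (by omega)] at f3
      exact h2 x y z w hxy hyz hzw (by omega) (by omega) (by omega) (by omega)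
    by_cases hwJ : w = J
    · subst hwJ
      rw [insf_eq] at f3
      rw [insf_lt (by omega)] at f2 f3
      exact h2 x y z w hxy hyz hzw (by omega) (by omega) (by omega) (by omega)
    · have : w = J + 1 := by omega
      subst this
      rw [insf_gt] at f3
      by_cases hz : z = J
      · subst hz; rw [insf_eq] at f2 f3
        rcases hA with hA | ⟨hJ, hA⟩
        · have := hA x y (by omega) (by omega) (by omega) (by omega); omega
        · have : y ≠ z - 1 := by rintro rfl; omega
          have : g x ≠ g (z - 1) := fun he => by
            have := hg _ _ (by omega) (by omega) he; omega
          exact h2 x y (z - 1) z hxy (by omega) (by omega) (by omega) (by omega) (by omega) (by omega)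
      · rw [insf_lt (by omega)] at f2 f3
        exact h2 x y z J hxy hyz (by omega) (by omega) (by omega) (by omega) (by omega)

open Classical in
theorem insf_goodP {J c g k} (hJ : 1 ≤ J) (hG : Good (J + 1) k g) (hg : Inj (J + 1) g)
    (hc : c < 2 * g J) (hm : ∃ a, a < J ∧ 2 * g a < c)
    (hA : (∀ x y, x < J → y < J → 2 * g x < c → 2 * g y < c → x = y) ∨
      (1 ≤ J ∧ c = 2 * g (J - 1) + 1)) :
    GoodP (J + 2) (k + if Key (J + 2) (insf J c g) J then 1 else 0) J (insf J c g) := by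
  have hv : insf J c g J < insf J c g (J + 1) := by rw [insf_eq, insf_gt]; exact hc
  have ho := insf_OE J c g
  have hav := insf_av hG.2.1 hG.2.2.1 hg hc hA
  refine ⟨⟨(ss_del hJ hv).2 (ho.symm.ss hG.1), hav.1, hav.2, ?_⟩, ?_, ?_⟩
  · rw [kc_del hv, ho.kc, hG.2.2.2]
  · obtain ⟨a, ha, ha'⟩ := hm
    refine ⟨a, J + 1, ha, by omega, by omega, ?_, hv⟩
    rw [insf_eq, insf_lt ha]; exact ha'
  · intro i hi hmm
    have := mid_lt hmm
    omega

theorem key_iff_v {J k f} (h : GoodP (J + 2) k J f) :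
    Key (J + 2) f J ↔ (f (J - 1) < f J ∨ f (J + 1) < f (J - 1)) := by
  have hv := goodP_v h
  unfold Key
  have hJ := (mid_lt h.2.1).1
  constructor
  · rintro ⟨_, h | h⟩
    · exact Or.inl h
    · exact Or.inr (h _ (by omega) (by omega))
  · intro hh
    refine ⟨h.2.1, hh.imp id ?_⟩
    intro h' m h1 h2
    have : m = J ∨ m = J + 1 := by omega
    rcases this with rfl | rfl <;> omega

theorem del_inj (J i k : ℕ) (h : del J i = del J k) : i = k := by
  unfold del at h; split_ifs at h <;> omega

theorem del_bd (J i : ℕ) (h : i < J + 1) : del J i < J + 2 := by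
  unfold del; split_ifs <;> omega

theorem min_single {J g a} (hg : Inj (J + 1) g) (ham : ∀ i, i < J + 1 → g a ≤ g i) (ha : a < J + 1) :
    ∀ x y, x < J → y < J → 2 * g x < 2 * g a + 1 → 2 * g y < 2 * g a + 1 → x = y := by
  intro x y hx hy h1 h2
  have := ham x (by omega)
  have := ham y (by omega)
  exact hg _ _ (by omega) (by omega) (by omega)

theorem cardK (J k : ℕ) (hJ : 1 ≤ J) :
    Nat.card {π : Equiv.Perm (Fin (J + 2)) | GoodP (J + 2) (k + 1) J (sq π) ∧ Key (J + 2) (sq π) J} =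
    Nat.card {π : Equiv.Perm (Fin (J + 1)) | Good (J + 1) k (sq π) ∧ ∃ a, a < J ∧ sq π a < sq π J} := by
  classical
  apply card_del (J + 2) (J + 1) (del J) (del_bd J) (fun i k _ _ h => del_inj J i k h)
    (fun f => GoodP (J + 2) (k + 1) J f ∧ Key (J + 2) f J)
    (fun f => Good (J + 1) k f ∧ ∃ a, a < J ∧ f a < f J)
  · exact fun f g h ⟨h1, h2⟩ => ⟨h.goodP h1, h.key h2⟩
  · exact fun f g h ⟨h1, a, h2, h3⟩ => ⟨h.good h1, a, h2, (h _ _ (by omega) (by omega)).1 h3⟩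
  · rintro f hf ⟨hG, hK⟩
    obtain ⟨hv, a, ha, hav⟩ := goodP_v hG
    have hh := av_del hG.1.2.1 hG.1.2.2.1
    refine ⟨⟨(ss_del hJ hv).1 hG.1.1, hh.1, hh.2, ?_⟩, a, ha, ?_⟩
    · have := kc_del hv
      rw [hG.1.2.2.2, if_pos hK] at this
      omega
    · simp only [Function.comp, del_lt ha, del_ge (le_refl J)]
      omega
  · rintro g hg ⟨hG, b, hb, hbJ⟩
    obtain ⟨a, ha, ham⟩ := exists_min J g
    have haJ : a < J := by
      have := ham b (by omega)
      by_contra hc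
      have : a = J := by omega
      subst this
      omega
    have hab := ham b (by omega)
    have hap := ham (J - 1) (by omega)
    by_cases ht : g (J - 1) < g J
    · have hP := insf_goodP (c := 2 * g (J - 1) + 1) hJ hG hg (by omega) ⟨a, haJ, by omega⟩
        (Or.inr ⟨hJ, rfl⟩)
      have hk := (key_iff_v hP).2 (Or.inl (by rw [insf_eq, insf_lt (by omega)]; omega))
      rw [if_pos hk] at hP
      exact ⟨_, insf_inj hg (by omega), ⟨hP, hk⟩, insf_OE _ _ _⟩
    · have hP := insf_goodP (c := 2 * g a + 1) hJ hG hg (by omega) ⟨a, haJ, by omega⟩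
        (Or.inl (min_single hg ham ha))
      have hne : g (J - 1) ≠ g J := fun he => by
        have := hg _ _ (by omega) (by omega) he; omega
      have hk := (key_iff_v hP).2 (Or.inr (by rw [insf_gt, insf_lt (by omega)]; omega))
      rw [if_pos hk] at hP
      exact ⟨_, insf_inj hg (by omega), ⟨hP, hk⟩, insf_OE _ _ _⟩
  · rintro f f' hf hf' ⟨hP, hK⟩ ⟨hP', hK'⟩ ho
    have hv := (goodP_v hP).1
    have hv' := (goodP_v hP').1
    obtain ⟨c1, c2⟩ := OE_del_cmp ho
    apply OE_of_loc hv hv' hf hf' ho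
    intro i hi
    rw [key_iff_v hP] at hK
    rw [key_iff_v hP'] at hK'
    have e1 := c2 (J - 1) (by omega)
    by_cases ht : f (J - 1) < f J
    · have ht' : f' (J - 1) < f' J := by
        have := e1.1 (by omega); omega
      rw [loc_T2 hP hf hJ ht i hi, loc_T2 hP' hf' hJ ht' i hi]
      have := c1 (J - 1) i (by omega) hi
      omega
    · have hq : f (J + 1) < f (J - 1) := by omega
      have hq' : f' J < f' (J - 1) := by
        by_contra hc
        have := mt e1.2 (by omega); omega
      rw [loc_min hP hf hJ (Or.inl (by omega)) i hi, loc_min hP' hf' hJ (Or.inl hq') i hi]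
      apply forall_congr'; intro a
      apply forall_congr'; intro ha
      have := c1 a i ha hi
      omega

theorem cardN (J k : ℕ) (hJ : 1 ≤ J) :
    Nat.card {π : Equiv.Perm (Fin (J + 2)) | GoodP (J + 2) k J (sq π) ∧ ¬ Key (J + 2) (sq π) J} =
    Nat.card {π : Equiv.Perm (Fin (J + 1)) | GoodP (J + 1) k (J - 1) (sq π)} := by
  classical
  apply card_del (J + 2) (J + 1) (del J) (del_bd J) (fun i k _ _ h => del_inj J i k h)
    (fun f => GoodP (J + 2) k J f ∧ ¬ Key (J + 2) f J)
    (fun f => GoodP (J + 1) k (J - 1) f)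
  · exact fun f g h ⟨h1, h2⟩ => ⟨h.goodP h1, fun hk => h2 (h.symm.key hk)⟩
  · exact fun f g h h1 => h.goodP h1
  · rintro f hf ⟨hG, hK⟩
    obtain ⟨hv, a, ha, hav⟩ := goodP_v hG
    have hh := av_del hG.1.2.1 hG.1.2.2.1
    refine ⟨⟨(ss_del hJ hv).1 hG.1.1, hh.1, hh.2, ?_⟩, ⟨a, J, ?_⟩, ?_⟩
    · have := kc_del hv
      rw [hG.1.2.2.2, if_neg hK] at this
      omega
    · rw [key_iff_v hG] at hK
      have n1 : f (J - 1) ≠ f (J + 1) := fun he => by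
        have := hf _ _ (by omega) (by omega) he; omega
      have n2 : a ≠ J - 1 := by rintro rfl; omega
      refine ⟨by omega, by omega, by omega, ?_, ?_⟩
      · simp only [Function.comp, del_lt ha, del_lt (show J - 1 < J by omega)]; omega
      · simp only [Function.comp, del_ge (le_refl J), del_lt (show J - 1 < J by omega)]; omega
    · intro i hi hm
      have := mid_lt hm; omega
  · rintro g hg ⟨hG, ⟨b, b', hb1, hb2, hb3, hb4, hb5⟩, -⟩
    have : b' = J := by omega
    subst this
    obtain ⟨a, ha, ham⟩ := exists_min b' g
    have hab := ham b (by omega)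
    have haJ : a < b' := by
      by_contra hc
      have : a = b' := by omega
      subst this
      omega
    have hP := insf_goodP (c := 2 * g a + 1) hJ hG hg (by omega) ⟨a, haJ, by omega⟩
        (Or.inl (min_single hg ham ha))
    have hk : ¬ _ := mt (key_iff_v hP).1 (by
      rw [insf_gt, insf_eq, insf_lt (by omega)]; omega)
    rw [if_neg hk] at hP
    exact ⟨_, insf_inj hg (by omega), ⟨hP, hk⟩, insf_OE _ _ _⟩
  · rintro f f' hf hf' ⟨hP, hK⟩ ⟨hP', hK'⟩ ho
    have hv := (goodP_v hP).1
    have hv' := (goodP_v hP').1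
    obtain ⟨c1, c2⟩ := OE_del_cmp ho
    apply OE_of_loc hv hv' hf hf' ho
    intro i hi
    rw [key_iff_v hP] at hK
    rw [key_iff_v hP'] at hK'
    have n1 : f (J - 1) ≠ f J := fun he => by
      have := hf _ _ (by omega) (by omega) he; omega
    have n2 : f' (J - 1) ≠ f' J := fun he => by
      have := hf' _ _ (by omega) (by omega) he; omega
    rw [loc_min hP hf hJ (Or.inl (by omega)) i hi, loc_min hP' hf' hJ (Or.inl (by omega)) i hi]
    apply forall_congr'; intro a
    apply forall_congr'; intro ha
    have := c1 a i ha hi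
    omega

/-- dropping a final minimum -/
theorem key_last {J f i} (hm : ∀ a, a < J → f J < f a) : Key (J + 1) f i ↔ Key J f i := by
  have h1 : Mid (J + 1) f i ↔ Mid J f i := by
    constructor
    · rintro ⟨a, b, h1, h2, h3, h4, h5⟩
      have : b ≠ J := by
        rintro rfl
        have := hm i h2; omega
      exact ⟨a, b, h1, h2, by omega, h4, h5⟩
    · rintro ⟨a, b, h1, h2, h3, h4, h5⟩
      exact ⟨a, b, h1, h2, by omega, h4, h5⟩
  unfold Key
  rw [h1]
  apply and_congr_right
  intro hmm
  have h0 := mid_lt hmm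
  have : RLM (J + 1) f (i - 1) ↔ RLM J f (i - 1) := by
    constructor
    · intro h m h1 h2
      exact h m h1 (by omega)
    · intro h m h1 h2
      by_cases hh : m = J
      · subst hh; exact hm _ (by omega)
      · exact h m h1 (by omega)
  rw [this]

theorem good_last {J f k} (hJ : 1 ≤ J) (hm : ∀ a, a < J → f J < f a) :
    Good (J + 1) k f ↔ Good J k f := by
  classical
  have e1 : SS (J + 1) f ↔ SS J f := by
    constructor
    · rintro ⟨i, h1, h2⟩
      have : i ≠ J := by rintro rfl; have := hm 0 (by omega); omega
      exact ⟨i, by omega, h2⟩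
    · rintro ⟨i, h1, h2⟩
      exact ⟨i, by omega, h2⟩
  have e2 : Av1 (J + 1) f ↔ Av1 J f := by
    constructor
    · intro h i j k l h1 h2 h3 h4
      exact h i j k l h1 h2 h3 (by omega)
    · intro h i j k l h1 h2 h3 h4 h5 h6 h7
      have : l ≠ J := by rintro rfl; have := hm i (by omega); omega
      exact h i j k l h1 h2 h3 (by omega) h5 h6 h7
  have e3 : Av2 (J + 1) f ↔ Av2 J f := by
    constructor
    · intro h i j k l h1 h2 h3 h4
      exact h i j k l h1 h2 h3 (by omega)
    · intro h i j k l h1 h2 h3 h4 h5 h6 h7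
      have : l ≠ J := by rintro rfl; have := hm i (by omega); omega
      exact h i j k l h1 h2 h3 (by omega) h5 h6 h7
  have e4 : kc (J + 1) f = kc J f := by
    rw [kc_sum, kc_sum, Finset.sum_range_succ]
    have : ¬ Key (J + 1) f J := fun h => by have := mid_lt h.1; omega
    rw [if_neg this, add_zero]
    simp only [key_last hm]
  unfold Good
  rw [e1, e2, e3, e4]

theorem card0 (J k : ℕ) (hJ : 1 ≤ J) :
    Nat.card {π : Equiv.Perm (Fin (J + 1)) | Good (J + 1) k (sq π) ∧ ∀ a, a < J → sq π J < sq π a} =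
    Nat.card {π : Equiv.Perm (Fin J) | Good J k (sq π)} := by
  apply card_del (J + 1) J id (fun i h => by simp; omega) (fun i k _ _ h => h)
    (fun f => Good (J + 1) k f ∧ ∀ a, a < J → f J < f a)
    (fun f => Good J k f)
  · exact fun f g h ⟨h1, h2⟩ => ⟨h.good h1, fun a ha => (h _ _ (by omega) (by omega)).1 (h2 a ha)⟩
  · exact fun f g h h1 => h.good h1
  · rintro f hf ⟨hG, hm⟩
    exact (good_last hJ hm).1 hG
  · intro g hg hG
    let f : ℕ → ℕ := fun i => if i < J then g i + 1 else 0
    have fl : ∀ i, i < J → f i = g i + 1 := fun i hi => by simp [f, hi]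
    have fJ : f J = 0 := by simp [f]
    have hm : ∀ a, a < J → f J < f a := fun a ha => by rw [fJ, fl a ha]; omega
    have ho : OE J f g := fun i k hi hk => by rw [fl i hi, fl k hk]; omega
    refine ⟨f, ?_, ⟨(good_last hJ hm).2 (ho.symm.good hG), hm⟩, ho⟩
    intro i k hi hk he
    by_cases h1 : i < J <;> by_cases h2 : k < J
    · rw [fl i h1, fl k h2] at he
      exact hg i k h1 h2 (by omega)
    · have : k = J := by omega
      subst this
      have := hm i h1; omega
    · have : i = J := by omega
      subst this
      have := hm k h2; omega
    · omega
  · rintro f f' hf hf' ⟨_, hm⟩ ⟨_, hm'⟩ ho i k hi hk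
    by_cases h1 : i < J <;> by_cases h2 : k < J
    · exact ho i k h1 h2
    · have : k = J := by omega
      subst this
      have := hm i h1; have := hm' i h1; omega
    · have : i = J := by omega
      subst this
      have := hm k h2; have := hm' k h2; omega
    · have : i = J := by omega
      have : k = J := by omega
      subst i; subst k; simp

theorem card_split {α : Type*} [Finite α] (P Q : α → Prop) :
    Nat.card {x | P x} = Nat.card {x | P x ∧ Q x} + Nat.card {x | P x ∧ ¬ Q x} := by
  rw [Nat.card_coe_set_eq, Nat.card_coe_set_eq, Nat.card_coe_set_eq,
    ← Set.ncard_union_eq _ (Set.toFinite _) (Set.toFinite _)]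
  · congr 1
    ext x
    simp only [Set.mem_union, Set.mem_ofPred_eq]
    tauto
  · rw [Set.disjoint_left]
    rintro x ⟨_, h⟩ ⟨_, h'⟩
    exact h' h

theorem cardII (J k : ℕ) :
    Nat.card {π : Equiv.Perm (Fin (J + 2)) | GoodP (J + 2) (k + 1) J (sq π)} =
    Nat.card {π : Equiv.Perm (Fin (J + 1)) | Good (J + 1) k (sq π)} := by
  induction J with
  | zero =>
    have h1 : {π : Equiv.Perm (Fin (0 + 2)) | GoodP (0 + 2) (k + 1) 0 (sq π)} = ∅ := by
      ext π
      simp only [Set.mem_ofPred_eq, Set.mem_empty_iff_false, iff_false]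
      intro h
      have := mid_lt h.2.1; omega
    have h2 : {π : Equiv.Perm (Fin (0 + 1)) | Good (0 + 1) k (sq π)} = ∅ := by
      ext π
      simp only [Set.mem_ofPred_eq, Set.mem_empty_iff_false, iff_false]
      rintro ⟨⟨i, h1, h2⟩, _⟩
      have : i = 0 := by omega
      subst this; omega
    rw [h1, h2]; simp
  | succ J ih =>
    have hN := cardN (J + 1) (k + 1) (by omega)
    rw [Nat.add_sub_cancel] at hN
    rw [card_split (fun π : Equiv.Perm (Fin (J + 1 + 2)) => GoodP (J + 1 + 2) (k + 1) (J + 1) (sq π))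
      (fun π => Key (J + 1 + 2) (sq π) (J + 1)),
      cardK (J + 1) k (by omega), hN, ih, ← card0 (J + 1) k (by omega),
      card_split (fun π : Equiv.Perm (Fin (J + 1 + 1)) => Good (J + 1 + 1) k (sq π))
      (fun π => ∃ a, a < J + 1 ∧ sq π a < sq π (J + 1))]
    congr 2
    apply congrArg
    ext π
    simp only [Set.mem_ofPred_eq]
    apply and_congr_right
    intro _
    push Not
    apply forall_congr'; intro a
    apply forall_congr'; intro ha
    have : sq π (J + 1) ≠ sq π a := fun he => by
      have := sq_inj π _ _ (by omega) (by omega) he; omega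
    omega

end St

namespace St

structure Cross (n J : ℕ) (f : ℕ → ℕ) (pa pb : ℕ) : Prop where
  a_lt : pa < J
  lt_b : J < pb
  b_lt : pb < n
  fa : f pa < f J
  fb : f J < f pb
  qb : ∀ q, J < q → q < n → q ≠ pb → f q < f pb
  qi : ∀ q, J < q → q < n → q ≠ pb → ∀ i, i ≤ J → i ≠ pa → f q < f i
  ai : ∀ i, i ≤ J → i ≠ pa → f pa < f i

def e1 (J pb : ℕ) : ℕ → ℕ := fun i => if i ≤ J then i else pb
def e2 (J pa : ℕ) : ℕ → ℕ := fun q => if q = 0 then pa else J + q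

theorem e1_le {J pb i} (h : i ≤ J) : e1 J pb i = i := by simp [e1, h]
theorem e1_gt {J pb} : e1 J pb (J + 1) = pb := by simp [e1]
theorem e2_0 {J pa} : e2 J pa 0 = pa := by simp [e2]
theorem e2_pos {J pa q} (h : 0 < q) : e2 J pa q = J + q := by simp [e2]; omega

theorem OE.cross {n J f g pa pb} (h : OE n f g) (hc : Cross n J f pa pb) : Cross n J g pa pb := by
  obtain ⟨h1, h2, h3, h4, h5, h6, h7, h8⟩ := hc
  refine ⟨h1, h2, h3, (h _ _ (by omega) (by omega)).1 h4, (h _ _ (by omega) (by omega)).1 h5, ?_, ?_, ?_⟩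
  · intro q a b c
    exact (h _ _ (by omega) (by omega)).1 (h6 q a b c)
  · intro q a b c i d e
    exact (h _ _ (by omega) (by omega)).1 (h7 q a b c i d e)
  · intro i d e
    exact (h _ _ (by omega) (by omega)).1 (h8 i d e)

theorem exists_cross {n J k f} (hf : Inj n f) (h : GoodP n k J f) : ∃ pa pb, Cross n J f pa pb := by
  obtain ⟨⟨_, av1, av2, _⟩, ⟨i0, pb, h1, h2, h3, h4, h5⟩, hno⟩ := h
  obtain ⟨pa, ha, ham⟩ := exists_min J f
  have ne : ∀ i k, i < n → k < n → i ≠ k → f i ≠ f k := fun i k hi hk hik he => hik (hf i k hi hk he)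
  have haJ : pa < J := by
    by_contra hc
    have : pa = J := by omega
    subst this
    have := ham i0 (by omega); omega
  have ai : ∀ i, i ≤ J → i ≠ pa → f pa < f i := by
    intro i hi hn
    have := ham i (by omega)
    have := ne i pa (by omega) (by omega) hn
    omega
  have aJ := ai J le_rfl (by omega)
  have qJ : ∀ q, J < q → q < n → q ≠ pb → f q < f J := by
    intro q q1 q2 q3
    by_contra hc
    have n1 := ne q J q2 (by omega) (by omega)
    have n2 := ne q pb q2 h3 q3
    have key : ∀ x y, J < x → x < y → y < n → f J < f x → f J < f y → False := by
      intro x y x1 x2 x3 x4 x5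
      have n3 := ne x y (by omega) (by omega) (by omega)
      by_cases hxy : f x < f y
      · exact hno x x1 ⟨J, y, x1, x2, x3, x4, hxy⟩
      · exact av1 i0 J x y h1 x1 x2 x3 h4 x5 (by omega)
    by_cases hqb : q < pb
    · exact key q pb q1 hqb h3 (by omega) h5
    · exact key pb q h2 (by omega) q2 h5 (by omega)
  refine ⟨pa, pb, haJ, h2, h3, aJ, h5, ?_, ?_, ai⟩
  · intro q q1 q2 q3
    have := qJ q q1 q2 q3
    omega
  · intro q q1 q2 q3 i hi hia
    have hq := qJ q q1 q2 q3
    by_contra hc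
    have hiJ : i ≠ J := by rintro rfl; omega
    have n1 := ne q i (by omega) (by omega) (by omega)
    have hai := ai i hi hia
    by_cases hpi : pa < i
    · by_cases hqb : q < pb
      · exact hno q q1 ⟨pa, pb, by omega, hqb, h3, by omega, by omega⟩
      · exact av1 pa i pb q hpi (by omega) (by omega) q2 hai (by omega) (by omega)
    · exact av2 i pa J pb (by omega) haJ h2 h3 hai (by omega) h5

theorem e1_mono {J pb i k} (hb : J < pb) (h : i < k) (hk : k < J + 2) : e1 J pb i < e1 J pb k := by
  unfold e1; split_ifs <;> omega

theorem e2_mono {J pa i k} (hb : pa < J) (h : i < k) : e2 J pa i < e2 J pa k := by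
  unfold e2; split_ifs <;> omega

theorem cross_key {n J f pa pb i} (hc : Cross n J f pa pb) (hi : i ≤ J) :
    Key n f i ↔ Key (J + 2) (f ∘ e1 J pb) i := by
  obtain ⟨h1, h2, h3, h4, h5, h6, h7, h8⟩ := hc
  have hle : ∀ q, J < q → q < n → f q ≤ f pb := by
    intro q a b
    by_cases hq : q = pb
    · rw [hq]
    · exact (h6 q a b hq).le
  have hm : Mid n f i ↔ Mid (J + 2) (f ∘ e1 J pb) i := by
    constructor
    · rintro ⟨a, b, x1, x2, x3, x4, x5⟩
      by_cases hb : b ≤ J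
      · refine ⟨a, b, x1, x2, by omega, ?_, ?_⟩
        · simpa only [Function.comp, e1_le hi, e1_le (show a ≤ J by omega)]
        · simpa only [Function.comp, e1_le hi, e1_le hb]
      · refine ⟨a, J + 1, x1, by omega, by omega, ?_, ?_⟩
        · simpa only [Function.comp, e1_le hi, e1_le (show a ≤ J by omega)]
        · simp only [Function.comp, e1_le hi, e1_gt]
          have := hle b (by omega) x3
          omega
    · rintro ⟨a, b, x1, x2, x3, x4, x5⟩
      simp only [Function.comp, e1_le hi, e1_le (show a ≤ J by omega)] at x4 x5
      refine ⟨a, e1 J pb b, x1, ?_, ?_, x4, x5⟩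
      · unfold e1; split_ifs <;> omega
      · unfold e1; split_ifs <;> omega
  unfold Key
  rw [hm]
  apply and_congr_right
  intro hmm
  have h0 := mid_lt hmm
  have hi1 : i - 1 ≤ J := by omega
  have hr : RLM n f (i - 1) ↔ RLM (J + 2) (f ∘ e1 J pb) (i - 1) := by
    constructor
    · intro h m x1 x2
      simp only [Function.comp, e1_le hi1]
      apply h <;> (unfold e1; split_ifs <;> omega)
    · intro h m x1 x2
      by_cases hb : m ≤ J
      · have := h m x1 (by omega)
        simpa only [Function.comp, e1_le hi1, e1_le hb] using this
      · have hh := h (J + 1) (by omega) (by omega)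
        simp only [Function.comp, e1_le hi1, e1_gt] at hh
        have := hle m (by omega) x2
        omega
  rw [hr]
  simp only [Function.comp, e1_le hi, e1_le hi1]

theorem cross_kc {n J f pa pb} (hc : Cross n J f pa pb) (hno : ∀ i, J < i → ¬ Mid n f i) :
    kc n f = kc (J + 2) (f ∘ e1 J pb) := by
  unfold kc
  congr 1
  ext i
  simp only [Finset.mem_filter, Finset.mem_range]
  have := hc.lt_b
  have := hc.b_lt
  constructor
  · rintro ⟨h1, h2⟩
    by_cases hi : i ≤ J
    · exact ⟨by omega, (cross_key hc hi).1 h2⟩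
    · exact absurd h2.1 (hno i (by omega))
  · rintro ⟨h1, h2⟩
    have := mid_lt h2.1
    exact ⟨by omega, (cross_key hc (by omega)).2 h2⟩

theorem e1_inj {n J f pa pb} (hc : Cross n J f pa pb) (hf : Inj n f) : Inj (J + 2) (f ∘ e1 J pb) := by
  have h2 := hc.lt_b
  have h3 := hc.b_lt
  intro i k hi hk he
  have := hf _ _ (by unfold e1; split_ifs <;> omega) (by unfold e1; split_ifs <;> omega) he
  unfold e1 at this; split_ifs at this <;> omega

theorem e2_inj {n J f pa pb} (hc : Cross n J f pa pb) (hf : Inj n f) : Inj (n - J) (f ∘ e2 J pa) := by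
  have h1 := hc.a_lt
  have h2 := hc.lt_b
  have h3 := hc.b_lt
  intro i k hi hk he
  have := hf _ _ (by unfold e2; split_ifs <;> omega) (by unfold e2; split_ifs <;> omega) he
  unfold e2 at this; split_ifs at this <;> omega

theorem cross_fwd {n J k f pa pb} (hc : Cross n J f pa pb) (hf : Inj n f) (hG : GoodP n k J f) :
    GoodP (J + 2) k J (f ∘ e1 J pb) ∧ Good (n - J) 0 (f ∘ e2 J pa) := by
  have hk := cross_kc hc hG.2.2
  have hi2 := e2_inj hc hf
  obtain ⟨h1, h2, h3, h4, h5, h6, h7, h8⟩ := hc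
  obtain ⟨⟨ss, av1, av2, kk⟩, _, hno⟩ := hG
  have b1 : ∀ i, e1 J pb i < n := fun i => by unfold e1; split_ifs <;> omega
  have b2 : ∀ i, i < n - J → e2 J pa i < n := fun i hi => by unfold e2; split_ifs <;> omega
  refine ⟨⟨⟨?_, ?_, ?_, by omega⟩, ?_, ?_⟩, ?_, ?_, ?_, ?_⟩
  · obtain ⟨i, x1, x2⟩ := ss
    by_cases hi : i ≤ J
    · refine ⟨i, by omega, ?_⟩
      simpa only [Function.comp, e1_le hi, e1_le (Nat.zero_le J)]
    · refine ⟨J + 1, by omega, ?_⟩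
      simp only [Function.comp, e1_gt, e1_le (Nat.zero_le J)]
      by_cases hb : i = pb
      · rwa [← hb]
      · have := h6 i (by omega) x1 hb
        omega
  · intro i j k l x1 x2 x3 x4
    exact av1 _ _ _ _ (e1_mono h2 x1 (by omega)) (e1_mono h2 x2 (by omega)) (e1_mono h2 x3 x4) (b1 _)
  · intro i j k l x1 x2 x3 x4
    exact av2 _ _ _ _ (e1_mono h2 x1 (by omega)) (e1_mono h2 x2 (by omega)) (e1_mono h2 x3 x4) (b1 _)
  · refine ⟨pa, J + 1, h1, by omega, by omega, ?_, ?_⟩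
    · simpa only [Function.comp, e1_le h1.le, e1_le (le_refl J)]
    · simpa only [Function.comp, e1_gt, e1_le (le_refl J)]
  · intro i hi hm
    have := mid_lt hm; omega
  · refine ⟨pb - J, by omega, ?_⟩
    simp only [Function.comp, e2_0, e2_pos (show 0 < pb - J by omega)]
    rw [show J + (pb - J) = pb by omega]
    omega
  · intro i j k l x1 x2 x3 x4
    exact av1 _ _ _ _ (e2_mono h1 x1) (e2_mono h1 x2) (e2_mono h1 x3) (b2 _ x4)
  · intro i j k l x1 x2 x3 x4
    exact av2 _ _ _ _ (e2_mono h1 x1) (e2_mono h1 x2) (e2_mono h1 x3) (b2 _ x4)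
  · rw [kc_zero hi2]
    rintro q ⟨x, y, x1, x2, x3, x4, x5⟩
    have hq : e2 J pa q = J + q := e2_pos (by omega)
    exact hno (e2 J pa q) (by omega) ⟨_, _, e2_mono h1 x1, e2_mono h1 x2, b2 _ x3, x4, x5⟩

theorem cross_bwd {n J k f pa pb} (hc : Cross n J f pa pb) (hf : Inj n f)
    (hG : GoodP (J + 2) k J (f ∘ e1 J pb)) (hG2 : Good (n - J) 0 (f ∘ e2 J pa)) : GoodP n k J f := by
  have hno2 := (kc_zero (e2_inj hc hf)).1 hG2.2.2.2
  have hkc := cross_kc hc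
  obtain ⟨h1, h2, h3, h4, h5, h6, h7, h8⟩ := hc
  obtain ⟨⟨ss, av1, av2, kk⟩, _, hno⟩ := hG
  have T : ∀ x y z, x < y → y < z → z < n → (x = pa ∨ J < x) → J < y → f x < f y → f y < f z → False := by
    intro x y z x1 x2 x3 hx hy f1 f2
    have ey : e2 J pa (y - J) = y := by rw [e2_pos (by omega)]; omega
    have ez : e2 J pa (z - J) = z := by rw [e2_pos (by omega)]; omega
    rcases hx with rfl | hx
    · exact hno2 (y - J) ⟨0, z - J, by omega, by omega, by omega,
        by simpa only [Function.comp, ey, e2_0], by simpa only [Function.comp, ey, ez]⟩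
    · have ex : e2 J pa (x - J) = x := by rw [e2_pos (by omega)]; omega
      exact hno2 (y - J) ⟨x - J, z - J, by omega, by omega, by omega,
        by simpa only [Function.comp, ey, ex], by simpa only [Function.comp, ey, ez]⟩
  -- an entry below a non-b right entry is in the T-part
  have U : ∀ x q, J < q → q < n → q ≠ pb → f x < f q → (x = pa ∨ J < x) := by
    intro x q q1 q2 q3 hx
    by_contra hcc
    push Not at hcc
    have := h7 q q1 q2 q3 x hcc.2 hcc.1
    omega
  have hle : ∀ q, J < q → q < n → f q ≤ f pb := by
    intro q a b
    by_cases hq : q = pb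
    · rw [hq]
    · exact (h6 q a b hq).le
  have later : ∀ i, J < i → ¬ Mid n f i := by
    rintro i hi ⟨x, y, x1, x2, x3, x4, x5⟩
    have hib : i ≠ pb := by
      rintro rfl
      have := hle y (by omega) x3; omega
    exact T x i y x1 x2 x3 (U x i hi (by omega) hib x4) hi x4 x5
  have pull : ∀ i, (i ≤ J ∨ i = pb) → ∃ i', i' < J + 2 ∧ e1 J pb i' = i ∧
      (i' = i ∧ i ≤ J ∨ i' = J + 1 ∧ i = pb) := by
    rintro i (hi | rfl)
    · exact ⟨i, by omega, e1_le hi, Or.inl ⟨rfl, hi⟩⟩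
    · exact ⟨J + 1, by omega, e1_gt, Or.inr ⟨rfl, rfl⟩⟩
  refine ⟨⟨?_, ?_, ?_, by rw [hkc later, kk]⟩, ⟨pa, pb, h1, h2, h3, h4, h5⟩, later⟩
  · obtain ⟨i, x1, x2⟩ := ss
    refine ⟨e1 J pb i, by unfold e1; split_ifs <;> omega, ?_⟩
    simpa only [Function.comp, e1_le (Nat.zero_le J)] using x2
  · intro x y z w x1 x2 x3 x4 f1 f2 f3
    by_cases hw : w ≤ J ∨ w = pb
    · have hy : y ≤ J := by
        by_contra hy
        exact later y (by omega) ⟨x, z, x1, x2, by omega, f1, by omega⟩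
      have hz : z ≤ J := by
        by_contra hz
        have := hle z (by omega) (by omega)
        rcases hw with hw | rfl <;> omega
      obtain ⟨w', a1, a2, a3⟩ := pull w hw
      have ex : e1 J pb x = x := e1_le (by omega)
      have ey : e1 J pb y = y := e1_le (by omega)
      have ez : e1 J pb z = z := e1_le hz
      exact av1 x y z w' x1 x2 (by omega) a1 (by simpa only [Function.comp, ex, ey])
        (by simpa only [Function.comp, ey, a2]) (by simpa only [Function.comp, ez, a2])
    · push Not at hw
      have hy := U y w (by omega) x4 hw.2 f2
      have hx := U x w (by omega) x4 hw.2 (by omega)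
      have : J < y := by omega
      exact later y this ⟨x, z, x1, x2, by omega, f1, by omega⟩
  · intro x y z w x1 x2 x3 x4 f1 f2 f3
    have hz : z ≤ J := by
      by_contra hz
      exact later z (by omega) ⟨x, w, by omega, x3, x4, f2, f3⟩
    have key : ∀ w', w' < J + 2 → z < w' → f w = f w ∧ f z < (f ∘ e1 J pb) w' → False := by
      intro w' a1 a2 ⟨_, a3⟩
      have ex : e1 J pb x = x := e1_le (by omega)
      have ey : e1 J pb y = y := e1_le (by omega)
      have ez : e1 J pb z = z := e1_le hz
      exact av2 x y z w' x1 x2 a2 a1 (by simpa only [Function.comp, ex, ey])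
        (by simpa only [Function.comp, ex, ez]) (by simpa only [Function.comp, ez] using a3)
    by_cases hw : w ≤ J
    · exact key w (by omega) x3 ⟨rfl, by simpa only [Function.comp, e1_le hw]⟩
    · refine key (J + 1) (by omega) (by omega) ⟨rfl, ?_⟩
      simp only [Function.comp, e1_gt]
      have := hle w (by omega) x4
      omega

theorem cross_OE {n J f f' pa pb} (hc : Cross n J f pa pb) (hc' : Cross n J f' pa pb)
    (o1 : OE (J + 2) (f ∘ e1 J pb) (f' ∘ e1 J pb)) (o2 : OE (n - J) (f ∘ e2 J pa) (f' ∘ e2 J pa)) :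
    OE n f f' := by
  have E1 : ∀ i k, (i ≤ J ∨ i = pb) → (k ≤ J ∨ k = pb) → (f i < f k ↔ f' i < f' k) := by
    have pull : ∀ i, (i ≤ J ∨ i = pb) → ∃ i', i' < J + 2 ∧ e1 J pb i' = i := by
      rintro i (hi | rfl)
      · exact ⟨i, by omega, e1_le hi⟩
      · exact ⟨J + 1, by omega, e1_gt⟩
    intro i k hi hk
    obtain ⟨i', a, b⟩ := pull i hi
    obtain ⟨k', c, d⟩ := pull k hk
    simpa only [Function.comp, b, d] using o1 i' k' a c
  have hab : pa < J ∧ J < pb ∧ pb < n := ⟨hc.a_lt, hc.lt_b, hc.b_lt⟩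
  have E2 : ∀ i k, i < n → k < n → (i = pa ∨ J < i) → (k = pa ∨ J < k) → (f i < f k ↔ f' i < f' k) := by
    have pull : ∀ i, i < n → (i = pa ∨ J < i) → ∃ i', i' < n - J ∧ e2 J pa i' = i := by
      rintro i hi (rfl | hh)
      · exact ⟨0, by omega, e2_0⟩
      · exact ⟨i - J, by omega, by rw [e2_pos (by omega)]; omega⟩
    intro i k hi' hk' hi hk
    obtain ⟨i', a, b⟩ := pull i hi' hi
    obtain ⟨k', c, d⟩ := pull k hk' hk
    simpa only [Function.comp, b, d] using o2 i' k' a c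
  intro i k hi hk
  by_cases A1 : (i ≤ J ∨ i = pb) ∧ (k ≤ J ∨ k = pb)
  · exact E1 i k A1.1 A1.2
  by_cases A2 : (i = pa ∨ J < i) ∧ (k = pa ∨ J < k)
  · exact E2 i k hi hk A2.1 A2.2
  by_cases A3 : J < i
  · have := hc.qi i A3 hi (by omega) k (by omega) (by omega)
    have := hc'.qi i A3 hi (by omega) k (by omega) (by omega)
    omega
  · have := hc.qi k (by omega) hk (by omega) i (by omega) (by omega)
    have := hc'.qi k (by omega) hk (by omega) i (by omega) (by omega)
    omega

theorem exists_max (n : ℕ) (f : ℕ → ℕ) (hn : 1 ≤ n) : ∃ a, a < n ∧ ∀ i, i < n → f i ≤ f a := by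
  obtain ⟨a, h1, h2⟩ := Finset.exists_max_image (Finset.range n) f ⟨0, by simpa⟩
  exact ⟨a, by simpa using h1, fun i hi => h2 i (by simpa using hi)⟩

theorem glue {n J k g h} (hn : J + 1 < n) (hg : Inj (J + 2) g) (hh : Inj (n - J) h)
    (hP : GoodP (J + 2) k J g) (hS : SS (n - J) h) :
    ∃ f pa pb, Inj n f ∧ Cross n J f pa pb ∧ OE (J + 2) (f ∘ e1 J pb) g ∧
      OE (n - J) (f ∘ e2 J pa) h := by
  obtain ⟨hv, a0, ha0, ha0'⟩ := goodP_v hP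
  obtain ⟨pa, pa1, pam⟩ := exists_min (J + 1) g
  obtain ⟨q0, q1, qm⟩ := exists_max (n - J) h (by omega)
  have q0p : 0 < q0 := by
    by_contra hc
    have : q0 = 0 := by omega
    subst this
    obtain ⟨i, x1, x2⟩ := hS
    have := qm i x1; omega
  have paJ : pa < J := by
    have := pam a0 (by omega)
    by_contra hc
    have : pa = J ∨ pa = J + 1 := by omega
    rcases this with rfl | rfl <;> omega
  have gne : ∀ i, i < J + 2 → i ≠ pa → g pa < g i := by
    intro i hi hn
    have := pam i hi
    have : g i ≠ g pa := fun he => hn (hg _ _ hi pa1 he)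
    omega
  have hne : ∀ i, i < n - J → i ≠ q0 → h i < h q0 := by
    intro i hi hn
    have := qm i hi
    have : h i ≠ h q0 := fun he => hn (hh _ _ hi q1 he)
    omega
  obtain ⟨f, hfd⟩ : ∃ f : ℕ → ℕ, f = fun i => if i ≤ J then (if i = pa then h 0 else h q0 + 1 + g i) else
    if i = J + q0 then h q0 + 1 + g (J + 1) else h (i - J) := ⟨_, rfl⟩
  have fa : f pa = h 0 := by simp [hfd, paJ.le]
  have fi : ∀ i, i ≤ J → i ≠ pa → f i = h q0 + 1 + g i := fun i a b => by simp [hfd, a, b]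
  have fb : f (J + q0) = h q0 + 1 + g (J + 1) := by simp [hfd]; omega
  have fq : ∀ q, J < q → q ≠ J + q0 → f q = h (q - J) := fun q a b => by
    simp [hfd, b]; omega
  have h00 := hne 0 (by omega) (by omega)
  clear hfd
  have o1 : OE (J + 2) (f ∘ e1 J (J + q0)) g := by
    have v : ∀ i, i < J + 2 → i ≠ pa → (f ∘ e1 J (J + q0)) i = h q0 + 1 + g i := by
      intro i hi hia
      by_cases hJ : i ≤ J
      · simp only [Function.comp, e1_le hJ, fi i hJ hia]
      · have : i = J + 1 := by omega
        subst this
        simp only [Function.comp, e1_gt, fb]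
    have va : (f ∘ e1 J (J + q0)) pa = h 0 := by
      simp only [Function.comp, e1_le paJ.le, fa]
    intro i k hi hk
    by_cases hia : i = pa <;> by_cases hka : k = pa
    · subst hia; subst hka; simp
    · subst hia
      rw [va, v k hk hka]
      have := gne k hk hka; omega
    · subst hka
      rw [va, v i hi hia]
      have := gne i hi hia; omega
    · rw [v i hi hia, v k hk hka]; omega
  have o2 : OE (n - J) (f ∘ e2 J pa) h := by
    have v : ∀ i, i < n - J → i ≠ q0 → (f ∘ e2 J pa) i = h i := by
      intro i hi hia
      by_cases h0 : i = 0
      · subst h0; simp only [Function.comp, e2_0, fa]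
      · simp only [Function.comp, e2_pos (Nat.pos_of_ne_zero h0)]
        rw [fq _ (by omega) (by omega), Nat.add_sub_cancel_left]
    have vb : (f ∘ e2 J pa) q0 = h q0 + 1 + g (J + 1) := by
      simp only [Function.comp, e2_pos q0p, fb]
    intro i k hi hk
    by_cases hia : i = q0 <;> by_cases hka : k = q0
    · subst hia; subst hka; simp
    · subst hia
      rw [vb, v k hk hka]
      have := hne k hk hka; omega
    · subst hka
      rw [vb, v i hi hia]
      have := hne i hi hia; omega
    · rw [v i hi hia, v k hk hka]
  have hqi : ∀ q, J < q → q < n → q ≠ J + q0 → f q < h q0 := by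
    intro q a b c
    rw [fq q a c]; exact hne _ (by omega) (by omega)
  have hcr : Cross n J f pa (J + q0) := by
    refine ⟨paJ, by omega, by omega, ?_, ?_, ?_, ?_, ?_⟩
    · rw [fa, fi J le_rfl (by omega)]; omega
    · rw [fb, fi J le_rfl (by omega)]; omega
    · intro q a b c
      have := hqi q a b c; omega
    · intro q a b c i hi hia
      have := hqi q a b c
      rw [fi i hi hia]; omega
    · intro i hi hia
      rw [fa, fi i hi hia]; omega
  refine ⟨f, pa, J + q0, ?_, hcr, o1, o2⟩
  have i1 := o1.symm.inj hg
  have i2 := o2.symm.inj hh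
  have G1 : ∀ i k, i ≤ J → k ≤ J → f i = f k → i = k := by
    intro i k hi hk he
    exact i1 i k (by omega) (by omega) (by simpa only [Function.comp, e1_le hi, e1_le hk])
  have G2 : ∀ i k, J < i → J < k → i < n → k < n → f i = f k → i = k := by
    intro i k hi hk hin hkn he
    have := i2 (i - J) (k - J) (by omega) (by omega) (by
      simp only [Function.comp, e2_pos (show 0 < i - J by omega), e2_pos (show 0 < k - J by omega)]
      rwa [show J + (i - J) = i by omega, show J + (k - J) = k by omega])
    omega
  have G3 : ∀ i k, i ≤ J → J < k → k < n → f i ≠ f k := by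
    intro i k hi hk hkn he
    by_cases hkb : k = J + q0
    · subst hkb
      have := i1 i (J + 1) (by omega) (by omega) (by simpa only [Function.comp, e1_le hi, e1_gt])
      omega
    · by_cases hia : i = pa
      · subst hia
        have := i2 0 (k - J) (by omega) (by omega) (by
          simp only [Function.comp, e2_pos (show 0 < k - J by omega), e2_0]
          rwa [show J + (k - J) = k by omega])
        omega
      · have := hcr.qi k hk hkn hkb i hi hia
        omega
  intro i k hi hk he
  by_cases x : i ≤ J <;> by_cases y : k ≤ J
  · exact G1 i k x y he
  · exact absurd he (G3 i k x (by omega) hk)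
  · exact absurd he.symm (G3 k i y (by omega) hi)
  · exact G2 i k (by omega) (by omega) hi hk he

theorem cross_unique_a {n n' J f f' pa pb pa' pb'} (hc : Cross n J f pa pb) (hc' : Cross n' J f' pa' pb')
    (h : ∀ i k, i ≤ J → k ≤ J → (f i < f k ↔ f' i < f' k)) : pa = pa' := by
  by_contra hne
  have h1 := hc.a_lt
  have h2 := hc'.a_lt
  have := hc.ai pa' h2.le (by omega)
  have := hc'.ai pa h1.le (by omega)
  have := h pa pa' h1.le h2.le
  omega

theorem cross_unique_b {n J f f' pa pb pa' pb'} (hc : Cross n J f pa pb) (hc' : Cross n J f' pa' pb')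
    (h : ∀ i k, J < i → J < k → i < n → k < n → (f i < f k ↔ f' i < f' k)) : pb = pb' := by
  by_contra hne
  have h1 := hc.lt_b
  have h2 := hc'.lt_b
  have h3 := hc.b_lt
  have h4 := hc'.b_lt
  have := hc.qb pb' h2 h4 (by omega)
  have := hc'.qb pb h1 h3 (by omega)
  have := h pb pb' h1 h2 h3 h4
  omega

theorem e1_cmp {J f f' pb pb'} (ho : OE (J + 2) (f ∘ e1 J pb) (f' ∘ e1 J pb')) :
    ∀ i k, i ≤ J → k ≤ J → (f i < f k ↔ f' i < f' k) := by
  intro i k hi hk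
  simpa only [Function.comp, e1_le hi, e1_le hk] using ho i k (by omega) (by omega)

theorem e2_cmp {n J f f' pa pa'} (ho : OE (n - J) (f ∘ e2 J pa) (f' ∘ e2 J pa')) :
    ∀ i k, J < i → J < k → i < n → k < n → (f i < f k ↔ f' i < f' k) := by
  intro i k hi hk hin hkn
  have := ho (i - J) (k - J) (by omega) (by omega)
  simp only [Function.comp, e2_pos (show 0 < i - J by omega), e2_pos (show 0 < k - J by omega)] at this
  rwa [show J + (i - J) = i by omega, show J + (k - J) = k by omega] at this

theorem e1_comp {n J f f' pb} (hb : J < pb) (hn : pb < n) (h : OE n f f') :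
    OE (J + 2) (f ∘ e1 J pb) (f' ∘ e1 J pb) := by
  intro i k hi hk
  exact h _ _ (by unfold e1; split_ifs <;> omega) (by unfold e1; split_ifs <;> omega)

theorem e2_comp {n J f f' pa} (hb : pa < J) (hn : J < n) (h : OE n f f') :
    OE (n - J) (f ∘ e2 J pa) (f' ∘ e2 J pa) := by
  intro i k hi hk
  exact h _ _ (by unfold e2; split_ifs <;> omega) (by unfold e2; split_ifs <;> omega)

theorem cardI (n J k : ℕ) (hn : J + 1 < n) :
    Nat.card {π : Equiv.Perm (Fin n) | GoodP n k J (sq π)} =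
    Nat.card {π : Equiv.Perm (Fin (J + 2)) | GoodP (J + 2) k J (sq π)} *
    Nat.card {π : Equiv.Perm (Fin (n - J)) | Good (n - J) 0 (sq π)} := by
  rw [← Nat.card_prod, ← Nat.card_congr (Equiv.Set.prod _ _)]
  apply card_rel _ _ (fun π ρ => ∃ pa pb, Cross n J (sq π) pa pb ∧
    OE (J + 2) (sq π ∘ e1 J pb) (sq ρ.1) ∧ OE (n - J) (sq π ∘ e2 J pa) (sq ρ.2))
  · intro π hπ
    obtain ⟨pa, pb, hc⟩ := exists_cross (sq_inj π) hπ
    obtain ⟨x1, x2⟩ := cross_fwd hc (sq_inj π) hπ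
    obtain ⟨ρ, hρ⟩ := exists_perm (e1_inj hc (sq_inj π))
    obtain ⟨τ, hτ⟩ := exists_perm (e2_inj hc (sq_inj π))
    exact ⟨(ρ, τ), ⟨hρ.symm.goodP x1, hτ.symm.good x2⟩, pa, pb, hc, hρ.symm, hτ.symm⟩
  · rintro ⟨ρ, τ⟩ ⟨h1, h2⟩
    obtain ⟨f, pa, pb, fi, hc, o1, o2⟩ := glue hn (sq_inj ρ) (sq_inj τ) h1 h2.1
    obtain ⟨π, hπ⟩ := exists_perm fi
    refine ⟨π, hπ.symm.goodP (cross_bwd hc fi (o1.symm.goodP h1) (o2.symm.good h2)), pa, pb,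
      hπ.symm.cross hc, (e1_comp hc.lt_b hc.b_lt hπ).trans o1,
      (e2_comp hc.a_lt (by omega) hπ).trans o2⟩
  · rintro π hπ ⟨ρ, τ⟩ _ ⟨ρ', τ'⟩ _ ⟨pa, pb, hc, o1, o2⟩ ⟨pa', pb', hc', o1', o2'⟩
    have ea := cross_unique_a hc hc' (fun i k _ _ => Iff.rfl)
    have eb := cross_unique_b hc hc' (fun i k _ _ _ _ => Iff.rfl)
    subst ea; subst eb
    exact Prod.ext (perm_eq (o1.symm.trans o1')) (perm_eq (o2.symm.trans o2'))
  · rintro π hπ π' hπ' ⟨ρ, τ⟩ _ ⟨pa, pb, hc, o1, o2⟩ ⟨pa', pb', hc', o1', o2'⟩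
    have p1 := o1.trans o1'.symm
    have p2 := o2.trans o2'.symm
    have ea := cross_unique_a hc hc' (e1_cmp p1)
    have eb := cross_unique_b hc hc' (e2_cmp p2)
    subst ea; subst eb
    exact perm_eq (cross_OE hc hc' p1 p2)

theorem A_eq {n k} (hn : 1 ≤ n) : A n k = {π : Equiv.Perm (Fin n) | Good n k (sq π)} := by
  ext π; exact mem_A hn π

theorem Apos_eq {n k J} (hn : 1 ≤ n) :
    Apos n k (J + 1) = {π : Equiv.Perm (Fin n) | GoodP n k J (sq π)} := by
  ext π; exact mem_Apos hn π

end St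

theorem stmt4 (n k j : ℕ) (hk : 1 ≤ k) (hkj : k < j) (hjn : j ≤ n - 1) :
    Nat.card (Apos n k j) = Nat.card (A j (k - 1)) * Nat.card (A (n + 1 - j) 0) := by
  obtain ⟨J, rfl⟩ : ∃ J, j = J + 1 := ⟨j - 1, by omega⟩
  obtain ⟨k, rfl⟩ : ∃ k', k = k' + 1 := ⟨k - 1, by omega⟩
  rw [St.Apos_eq (by omega), St.A_eq (by omega), St.A_eq (by omega), St.cardI n J (k + 1) (by omega),
    St.cardII, Nat.add_sub_cancel, Nat.add_sub_add_right]
end
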